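/- Let m ≥ 4 and let γ : ℝ → ℝ^m be a C^∞ curve of finite type at 0 with γ'(0) ≠ 0, γ''(0) ∈ span{γ'(0)}, dim span{γ'(0), γ''(0), γ'''(0)} = 2, dim span{γ'(0), …, γ⁽⁴⁾(0)} = 3, and dim span{γ'(0), …, γ⁽⁵⁾(0)} = 4 (i.e. γ has type (1,3,4,5,a₅,…,a_m) at 0). Then the tangent map-germ Tan(γ)(s,t) = γ(t) + s·γ'(t) at (0,0) is diffeomorphic (right–left equivalent) to the open Mond surface map-germ (u,x) ↦ (u, x³ + ux², (3/4)x⁴ + (2/3)ux³, (3/5)x⁵ + (1/2)ux⁴, 0, …, 0) : (ℝ², 0) → (ℝ^m, 0). -/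

import Mathlib

open Filter Topology

/-- Two map-germs `f` at `a` and `g` at `b` are diffeomorphic (right-left equivalent):
there are germs of `C^∞` diffeomorphisms `σ : (E, a) → (E, b)` and
`τ : (F, f a) → (F, g b)` with `g ∘ σ = τ ∘ f` as germs at `a`. -/
def GermEquiv {E F : Type*} [NormedAddCommGroup E] [NormedSpace ℝ E]
    [NormedAddCommGroup F] [NormedSpace ℝ F]
    (f : E → F) (a : E) (g : E → F) (b : E) : Prop :=
  ∃ σ σinv : E → E, ∃ τ τinv : F → F,
    σ a = b ∧ τ (f a) = g b ∧
    ContDiffAt ℝ (⊤ : ℕ∞) σ a ∧ ContDiffAt ℝ (⊤ : ℕ∞) σinv b ∧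
    ContDiffAt ℝ (⊤ : ℕ∞) τ (f a) ∧ ContDiffAt ℝ (⊤ : ℕ∞) τinv (g b) ∧
    (∀ᶠ x in 𝓝 a, σinv (σ x) = x) ∧ (∀ᶠ y in 𝓝 b, σ (σinv y) = y) ∧
    (∀ᶠ z in 𝓝 (f a), τinv (τ z) = z) ∧ (∀ᶠ w in 𝓝 (g b), τ (τinv w) = w) ∧
    (∀ᶠ x in 𝓝 a, g (σ x) = τ (f x))
open Filter Topology
open scoped ContDiff

namespace Mond

theorem hasFDerivAt_param {E F : Type} [NormedAddCommGroup E] [NormedSpace ℝ E]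
    [FiniteDimensional ℝ E] [NormedAddCommGroup F] [NormedSpace ℝ F] [CompleteSpace F]
    (a b : ℝ) (Φ : E × ℝ → F) (h : ContDiff ℝ 1 Φ) (x : E) :
    HasFDerivAt (fun x => ∫ s in a..b, Φ (x, s))
      (∫ s in a..b, (fderiv ℝ Φ (x, s)).comp (ContinuousLinearMap.inl ℝ E ℝ)) x := by
  have : ProperSpace E := FiniteDimensional.proper ℝ E
  have hc : Continuous (fun p : E × ℝ => (fderiv ℝ Φ p).comp (ContinuousLinearMap.inl ℝ E ℝ)) :=
    (h.continuous_fderiv (by norm_num)).clm_comp continuous_const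
  obtain ⟨C, hC⟩ := ((isCompact_closedBall x (1:ℝ)).prod
    (isCompact_uIcc (a := a) (b := b))).exists_bound_of_continuousOn hc.continuousOn
  refine intervalIntegral.hasFDerivAt_integral_of_dominated_of_fderiv_le
    (F := fun x s => Φ (x, s)) (s := Metric.closedBall x 1)
    (F' := fun x s => (fderiv ℝ Φ (x, s)).comp (ContinuousLinearMap.inl ℝ E ℝ))
    (bound := fun _ => C) (Metric.closedBall_mem_nhds x one_pos) ?_ ?_ ?_ ?_ ?_ ?_
  · refine Eventually.of_forall fun y => Continuous.aestronglyMeasurable ?_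
    exact h.continuous.comp (by fun_prop)
  · exact (h.continuous.comp (by fun_prop : Continuous fun s : ℝ => (x, s))).intervalIntegrable _ _
  · exact (hc.comp (by fun_prop : Continuous fun s : ℝ => (x, s))).aestronglyMeasurable
  · refine Eventually.of_forall fun s hs y hy => hC (y, s) ⟨hy, Set.uIoc_subset_uIcc hs⟩
  · exact intervalIntegrable_const
  · refine Eventually.of_forall fun s hs y hy => ?_
    have h1 := ((h.differentiable (by norm_num)) (y, s)).hasFDerivAt
    exact h1.comp y (hasFDerivAt_prodMk_left y s)

theorem contDiff_param_nat (n : ℕ) : ∀ {E F : Type} [NormedAddCommGroup E] [NormedSpace ℝ E]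
    [FiniteDimensional ℝ E] [NormedAddCommGroup F] [NormedSpace ℝ F] [CompleteSpace F]
    (a b : ℝ) (Φ : E × ℝ → F) (_ : ContDiff ℝ ∞ Φ),
    ContDiff ℝ n (fun x => ∫ s in a..b, Φ (x, s)) := by
  induction n with
  | zero =>
    intro E F _ _ _ _ _ _ a b Φ h
    have : Differentiable ℝ (fun x => ∫ s in a..b, Φ (x, s)) := fun x =>
      (hasFDerivAt_param a b Φ (h.of_le (by exact_mod_cast le_top)) x).differentiableAt
    exact contDiff_zero.2 this.continuous
  | succ n ih =>
    intro E F _ _ _ _ _ _ a b Φ h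
    have hd := fun x => hasFDerivAt_param a b Φ (h.of_le (by exact_mod_cast le_top)) x
    rw [show ((n + 1 : ℕ) : ℕ∞ω) = (n : ℕ∞ω) + 1 by norm_cast, contDiff_succ_iff_fderiv]
    refine ⟨fun x => (hd x).differentiableAt, by simp, ?_⟩
    have : fderiv ℝ (fun x => ∫ s in a..b, Φ (x, s)) = fun x =>
      ∫ s in a..b, (fderiv ℝ Φ (x, s)).comp (ContinuousLinearMap.inl ℝ E ℝ) :=
      funext fun x => (hd x).fderiv
    rw [this]
    refine ih a b (fun p => (fderiv ℝ Φ p).comp (ContinuousLinearMap.inl ℝ E ℝ)) ?_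
    exact (h.fderiv_right (m := ∞) (by simp)).clm_comp contDiff_const

theorem contDiff_param {E F : Type} [NormedAddCommGroup E] [NormedSpace ℝ E]
    [FiniteDimensional ℝ E] [NormedAddCommGroup F] [NormedSpace ℝ F] [CompleteSpace F]
    (a b : ℝ) (Φ : E × ℝ → F) (h : ContDiff ℝ ∞ Φ) :
    ContDiff ℝ ∞ (fun x => ∫ s in a..b, Φ (x, s)) :=
  contDiff_infty.2 fun n => contDiff_param_nat n a b Φ h

/-- Hadamard lemma with a parameter. -/
theorem hadamard (Φ : ℝ × ℝ → ℝ) (h : ContDiff ℝ ∞ Φ) :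
    ∃ Ψ : ℝ × ℝ → ℝ, ContDiff ℝ ∞ Ψ ∧ (∀ u t, Φ (u, t) = Φ (t, t) + (u - t) * Ψ (u, t)) ∧
      ∀ t, HasDerivAt (fun u => Φ (u, t)) (Ψ (t, t)) t := by
  let D : ℝ × ℝ → ℝ := fun p => fderiv ℝ Φ p (1, 0)
  have hD : ContDiff ℝ ∞ D := (h.fderiv_right (m := ∞) (by simp)).clm_apply contDiff_const
  have hd : ∀ x t, HasDerivAt (fun u => Φ (u, t)) (D (x, t)) x := by
    intro x t
    have h1 := ((h.differentiable (by simp)) (x, t)).hasFDerivAt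
    exact h1.comp_hasDerivAt x ((hasDerivAt_id x).prodMk (hasDerivAt_const x t))
  refine ⟨fun p => ∫ s in (0:ℝ)..1, D (p.2 + s * (p.1 - p.2), p.2), ?_, ?_, ?_⟩
  · exact contDiff_param 0 1 (fun q : (ℝ × ℝ) × ℝ => D (q.1.2 + q.2 * (q.1.1 - q.1.2), q.1.2))
      (hD.comp (by fun_prop))
  · intro u t
    have h2 : ∀ s ∈ Set.uIcc (0:ℝ) 1, HasDerivAt (fun s => Φ (t + s * (u - t), t))
        (D (t + s * (u - t), t) * (u - t)) s := by
      intro s _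
      have := (hd (t + s * (u - t)) t).comp s
        (((hasDerivAt_id s).mul_const (u - t)).const_add t)
      simpa using! this
    have h3 := intervalIntegral.integral_eq_sub_of_hasDerivAt h2
      (Continuous.intervalIntegrable (by have := hD.continuous; fun_prop) _ _)
    rw [intervalIntegral.integral_mul_const] at h3
    simp only [one_mul, zero_mul, add_zero] at h3
    rw [show t + (u - t) = u by ring] at h3
    simp only
    linarith
  · intro t
    simpa using hd t t

theorem iteratedDeriv_id_mul (f : ℝ → ℝ) (hf : ContDiff ℝ ∞ f) (n : ℕ) :
    iteratedDeriv (n + 1) (fun t => t * f t) = 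
      fun t => t * iteratedDeriv (n + 1) f t + (n + 1) * iteratedDeriv n f t := by
  have hdiff : ∀ k, Differentiable ℝ (iteratedDeriv k f) := fun k =>
    hf.differentiable_iteratedDeriv k (by exact_mod_cast WithTop.coe_lt_top k)
  have hd : ∀ k t, HasDerivAt (iteratedDeriv k f) (iteratedDeriv (k + 1) f t) t := by
    intro k t
    rw [iteratedDeriv_succ]
    exact (hdiff k t).hasDerivAt
  induction n with
  | zero =>
    funext t
    rw [iteratedDeriv_one]
    have := (hasDerivAt_id t).mul (hd 0 t)
    simp only [iteratedDeriv_zero] at this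
    have := this.deriv
    simp only [id] at this
    refine Eq.trans this ?_
    simp; ring
  | succ n ih =>
    funext t
    rw [iteratedDeriv_succ, ih]
    have := ((hasDerivAt_id t).mul (hd (n+1) t)).add ((hd n t).const_mul ((n:ℝ) + 1))
    refine Eq.trans this.deriv ?_
    simp; ring

/-- Division by `t`. -/
theorem div_id (η : ℝ → ℝ) (hη : ContDiff ℝ ∞ η) (h0 : η 0 = 0) :
    ∃ e : ℝ → ℝ, ContDiff ℝ ∞ e ∧ (∀ t, η t = t * e t) ∧
      ∀ n, iteratedDeriv (n + 1) η 0 = (n + 1) * iteratedDeriv n e 0 := by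
  obtain ⟨Ψ, h1, h2, -⟩ := hadamard (fun p => η p.1) (hη.comp contDiff_fst)
  have h3 : ∀ t, η t = t * Ψ (t, 0) := by
    intro t
    have := h2 t 0
    simpa [h0] using this
  have hc : ContDiff ℝ ∞ (fun t => Ψ (t, 0)) := h1.comp (by fun_prop)
  refine ⟨fun t => Ψ (t, 0), hc, h3, fun n => ?_⟩
  have := iteratedDeriv_id_mul _ hc n
  rw [show η = fun t => t * Ψ (t, 0) from funext h3, this]
  simp

/-- Second-order Taylor formula with smooth remainder. -/
theorem taylor2 (e : ℝ → ℝ) (he : ContDiff ℝ ∞ e) :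
    ∃ R : ℝ × ℝ → ℝ, ContDiff ℝ ∞ R ∧
      (∀ u t, e u = e t + (u - t) * deriv e t + (u - t) ^ 2 * R (u, t)) ∧
      R (0, 0) = iteratedDeriv 2 e 0 / 2 := by
  obtain ⟨Ψ, h1, h2, h2'⟩ := hadamard (fun p => e p.1) (he.comp contDiff_fst)
  obtain ⟨R, h3, h4, h4'⟩ := hadamard Ψ h1
  have h5 : ∀ t, Ψ (t, t) = deriv e t := fun t => (h2' t).deriv.symm
  have h6 : ∀ u t, e u = e t + (u - t) * deriv e t + (u - t) ^ 2 * R (u, t) := by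
    intro u t
    have := h2 u t
    have h7 := h4 u t
    simp only at this
    rw [this, h7, h5]; ring
  refine ⟨R, h3, h6, ?_⟩
  -- compute via iterated derivative of `u ↦ e u`
  have hR : ContDiff ℝ ∞ (fun u => R (u, 0)) := h3.comp (by fun_prop)
  have e1 : e = fun u => e 0 + u * (deriv e 0 + u * R (u, 0)) := by
    funext u; have := h6 u 0; rw [this]; simp; ring
  have hg : ContDiff ℝ ∞ (fun u : ℝ => u * R (u, 0)) := by fun_prop
  have hg2 : ContDiff ℝ ∞ (fun u : ℝ => deriv e 0 + u * R (u, 0)) := by fun_prop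
  have k1 : iteratedDeriv 2 e 0 = iteratedDeriv 2 (fun u => u * (deriv e 0 + u * R (u, 0))) 0 := by
    conv_lhs => rw [e1]
    rw [iteratedDeriv_const_add]
    simp
  rw [k1, iteratedDeriv_id_mul _ hg2 1]
  have k2 : iteratedDeriv 1 (fun u => deriv e 0 + u * R (u, 0)) 0 = R (0, 0) := by
    rw [iteratedDeriv_const_add]
    rw [iteratedDeriv_id_mul _ hR 0]
    simp
    simp
  simp only [k2]
  norm_num

end Mond

open Filter Topology
open scoped ContDiff

namespace Mond

theorem globalize {E F : Type} [NormedAddCommGroup E] [NormedSpace ℝ E]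
    [FiniteDimensional ℝ E] [NormedAddCommGroup F] [NormedSpace ℝ F]
    (f : E → F) (x : E) (h : ∀ᶠ y in 𝓝 x, ContDiffAt ℝ ∞ f y) :
    ∃ g : E → F, ContDiff ℝ ∞ g ∧ g =ᶠ[𝓝 x] f := by
  obtain ⟨r, hr, hrU⟩ := Metric.eventually_nhds_iff_ball.1 h
  let b : ContDiffBump x := ⟨r / 4, r / 2, by positivity, by linarith⟩
  refine ⟨fun y => b y • f y, ?_, ?_⟩
  · rw [contDiff_iff_contDiffAt]
    intro y
    by_cases hy : y ∈ Metric.ball x r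
    · exact (b.contDiff.contDiffAt).smul (hrU y hy)
    · have : y ∉ tsupport b := by
        rw [b.tsupport_eq]
        intro hy'
        apply hy
        rw [Metric.mem_closedBall] at hy'
        rw [Metric.mem_ball]
        have : b.rOut = r / 2 := rfl
        linarith
      have h1 : b =ᶠ[𝓝 y] 0 := notMem_tsupport_iff_eventuallyEq.1 this
      have h2 : (fun y => b y • f y) =ᶠ[𝓝 y] fun _ => 0 := by
        filter_upwards [h1] with z hz
        simp [hz]
      exact contDiffAt_const.congr_of_eventuallyEq h2
  · filter_upwards [b.eventuallyEq_one] with y hy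
    simp [hy]

theorem smooth_inv {E : Type} [NormedAddCommGroup E] [NormedSpace ℝ E]
    [FiniteDimensional ℝ E] (Φ : E → E) (h : ContDiff ℝ ∞ Φ) (h0 : Φ 0 = 0)
    (hinj : ∀ w, fderiv ℝ Φ 0 w = 0 → w = 0) :
    ∃ Ψ : E → E, ContDiff ℝ ∞ Ψ ∧ Ψ 0 = 0 ∧ (∀ᶠ x in 𝓝 (0:E), Ψ (Φ x) = x) ∧
      (∀ᶠ y in 𝓝 (0:E), Φ (Ψ y) = y) := by
  have : CompleteSpace E := FiniteDimensional.complete ℝ E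
  have hinj' : Function.Injective (fderiv ℝ Φ 0 : E →ₗ[ℝ] E) := by
    rw [← LinearMap.ker_eq_bot, LinearMap.ker_eq_bot']
    exact hinj
  let L : E ≃L[ℝ] E := (LinearEquiv.ofInjectiveEndo _ hinj').toContinuousLinearEquiv
  have hL : (L : E →L[ℝ] E) = fderiv ℝ Φ 0 := by ext; rfl
  have hd : HasFDerivAt Φ (L : E →L[ℝ] E) 0 := by
    rw [hL]; exact (h.differentiable (by simp) 0).hasFDerivAt
  let H := (h.contDiffAt (x := 0)).toOpenPartialHomeomorph Φ hd (by simp)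
  have hH : (H : E → E) = Φ := rfl
  have hs : (0 : E) ∈ H.source := ContDiffAt.mem_toOpenPartialHomeomorph_source _ hd (by simp)
  have ht : (0 : E) ∈ H.target := by
    have := H.map_source hs
    rwa [hH, h0] at this
  have hsymm0 : H.symm 0 = 0 := by
    have := H.left_inv hs
    rwa [hH, h0] at this
  have hev : ∀ᶠ y in 𝓝 (0:E), ContDiffAt ℝ ∞ H.symm y := by
    have h1 : ∀ᶠ x in 𝓝 (0:E), fderiv ℝ Φ x ∈ Set.range ((↑) : (E ≃L[ℝ] E) → E →L[ℝ] E) := by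
      have hc := (h.continuous_fderiv (by simp)).continuousAt (x := (0:E))
      apply hc.eventually_mem
      rw [← hL]
      exact ContinuousLinearEquiv.nhds L
    have h2 : Tendsto H.symm (𝓝 0) (𝓝 0) := by
      have := H.continuousAt_symm ht
      rw [ContinuousAt, hsymm0] at this
      exact this
    filter_upwards [h2.eventually h1, H.open_target.mem_nhds ht] with y ⟨M, hM⟩ hy
    refine H.contDiffAt_symm hy (f₀' := M) ?_ h.contDiffAt
    rw [hM]
    exact (h.differentiable (by simp) _).hasFDerivAt
  obtain ⟨Ψ, hΨ, hΨe⟩ := globalize _ _ hev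
  refine ⟨Ψ, hΨ, by rw [hΨe.eq_of_nhds, hsymm0], ?_, ?_⟩
  · have hc : Tendsto Φ (𝓝 0) (𝓝 0) := by
      have := h.continuous.tendsto (0:E); rwa [h0] at this
    filter_upwards [hc.eventually hΨe, H.open_source.mem_nhds hs] with x hx hxs
    rw [hx]
    exact H.left_inv hxs
  · filter_upwards [hΨe, H.open_target.mem_nhds ht] with y hy hyt
    rw [hy]
    exact H.right_inv hyt

end Mond

open Filter Topology
open scoped ContDiff
namespace Mond

/-- A family of smooth functions all of whose derivatives are bounded uniformly over the family. -/
def UB {ι E F : Type} [NormedAddCommGroup E] [NormedSpace ℝ E]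
    [NormedAddCommGroup F] [NormedSpace ℝ F] (e : ι → E → F) : Prop :=
  (∀ i, ContDiff ℝ ∞ (e i)) ∧ ∀ n : ℕ, ∃ C : ℝ, ∀ i x, ‖iteratedFDeriv ℝ n (e i) x‖ ≤ C

section
variable {ι κ E F : Type} [NormedAddCommGroup E] [NormedSpace ℝ E]
    [NormedAddCommGroup F] [NormedSpace ℝ F]

theorem UB.reindex {e : ι → E → F} (h : UB e) (f : κ → ι) : UB (fun k => e (f k)) :=
  ⟨fun _ => h.1 _, fun n => (h.2 n).imp fun _ hC _ x => hC _ x⟩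

theorem UB.const (c : ι → F) (C : ℝ) (hc : ∀ i, ‖c i‖ ≤ C) : UB (fun i (_ : E) => c i) := by
  refine ⟨fun _ => contDiff_const, fun n => ⟨max C 0, fun i x => ?_⟩⟩
  rcases n with _ | n
  · rw [norm_iteratedFDeriv_zero]; exact (hc i).trans (le_max_left _ _)
  · rw [iteratedFDeriv_const_of_ne (by omega)]; simp

theorem UB.add {e f : ι → E → F} (he : UB e) (hf : UB f) : UB (fun i x => e i x + f i x) := by
  refine ⟨fun i => (he.1 i).add (hf.1 i), fun n => ?_⟩
  obtain ⟨C, hC⟩ := he.2 n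
  obtain ⟨D, hD⟩ := hf.2 n
  refine ⟨C + D, fun i x => ?_⟩
  have := iteratedFDeriv_add_apply (x := x) (((he.1 i).of_le (m := n) (by exact_mod_cast le_top)).contDiffAt)
    (((hf.1 i).of_le (m := n) (by exact_mod_cast le_top)).contDiffAt)
  change ‖iteratedFDeriv ℝ n (e i + f i) x‖ ≤ _
  rw [this]
  exact (norm_add_le _ _).trans (add_le_add (hC i x) (hD i x))

theorem UB.smul [NormedSpace ℂ F] [IsScalarTower ℝ ℂ F] {e : ι → E → ℂ} {f : ι → E → F} (he : UB e) (hf : UB f) :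
    UB (fun i x => e i x • f i x) := by
  refine ⟨fun i => (he.1 i).smul (hf.1 i), fun n => ?_⟩
  choose C hC using he.2
  choose D hD using hf.2
  refine ⟨∑ j ∈ Finset.range (n+1), (n.choose j : ℝ) * C j * D (n - j), fun i x => ?_⟩
  refine (norm_iteratedFDeriv_smul_le (he.1 i) (hf.1 i) x (n := n) (by exact_mod_cast le_top)).trans ?_
  refine Finset.sum_le_sum fun j _ => ?_
  have h0 : 0 ≤ C j := (norm_nonneg _).trans (hC j i x)
  gcongr
  · exact hC j i x
  · exact hD _ i x

theorem UB.mul {e f : ι → E → ℂ} (he : UB e) (hf : UB f) : UB (fun i x => e i x * f i x) :=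
  UB.smul he hf

theorem UB.neg {e : ι → E → ℂ} (he : UB e) : UB (fun i x => - e i x) := by
  have := (UB.const (ι := ι) (E := E) (fun _ => (-1:ℂ)) 1 (by simp)).mul he
  simpa using this

theorem UB.fderiv {e : ι → E → F} (he : UB e) : UB (fun i => fderiv ℝ (e i)) := by
  refine ⟨fun i => (he.1 i).fderiv_right (by simp), fun n => ?_⟩
  obtain ⟨C, hC⟩ := he.2 (n+1)
  exact ⟨C, fun i x => by rw [norm_iteratedFDeriv_fderiv]; exact hC i x⟩

theorem UB.inv {b : ι → E → ℂ} (hb : UB b) (a : ι → ℂ) (hab : ∀ i x, 1 ≤ ‖a i + b i x‖) :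
    UB (fun i x => (a i + b i x)⁻¹) := by
  have hne : ∀ i x, a i + b i x ≠ 0 := fun i x h0 => by
    have := hab i x; rw [h0] at this; norm_num at this
  have hsm : ∀ i, ContDiff ℝ ∞ (fun x => (a i + b i x)⁻¹) := fun i =>
    (contDiff_const.add (hb.1 i)).inv (hne i)
  refine ⟨hsm, fun n => ?_⟩
  induction n using Nat.strong_induction_on with
  | _ n ih =>
    rcases n with _ | n
    · refine ⟨1, fun i x => ?_⟩
      rw [norm_iteratedFDeriv_zero, norm_inv]
      exact inv_le_one_of_one_le₀ (hab i x)
    · choose! C hC using ih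
      choose D hD using hb.fderiv.2
      have hg2 : ∀ j ≤ n, ∀ i x, ‖iteratedFDeriv ℝ j (fun x => (a i + b i x)⁻¹ * (a i + b i x)⁻¹) x‖ ≤
          ∑ l ∈ Finset.range (j+1), (j.choose l : ℝ) * C l * C (j - l) := by
        intro j hj i x
        refine (norm_iteratedFDeriv_mul_le (hsm i) (hsm i) x (n := j) (by exact_mod_cast le_top)).trans ?_
        refine Finset.sum_le_sum fun l hl => ?_
        have hl' : l ≤ j := by simpa [Nat.lt_succ_iff] using hl
        have h0 : 0 ≤ C l := (norm_nonneg _).trans (hC l (by omega) i x)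
        gcongr
        · exact hC l (by omega) i x
        · exact hC _ (by omega) i x
      refine ⟨∑ j ∈ Finset.range (n+1), (n.choose j : ℝ) *
        (∑ l ∈ Finset.range (j+1), (j.choose l : ℝ) * C l * C (j - l)) * D (n-j), fun i x => ?_⟩
      rw [← norm_iteratedFDeriv_fderiv]
      have hfd : _root_.fderiv ℝ (fun x => (a i + b i x)⁻¹) =
          fun x => -(((a i + b i x)⁻¹ * (a i + b i x)⁻¹) • _root_.fderiv ℝ (b i) x) := by
        funext x
        have h1 : HasFDerivAt (fun x => a i + b i x) (_root_.fderiv ℝ (b i) x) x :=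
          (((hb.1 i).differentiable (by simp)) x).hasFDerivAt.const_add _
        have h2 := (hasDerivAt_inv (hne i x)).hasFDerivAt.restrictScalars ℝ
        refine (h2.comp x h1).fderiv.trans ?_
        ext v
        simp [pow_two, mul_comm]
      rw [hfd]
      change ‖iteratedFDeriv ℝ n (-(fun x => ((a i + b i x)⁻¹ * (a i + b i x)⁻¹) • _root_.fderiv ℝ (b i) x)) x‖ ≤ _
      rw [iteratedFDeriv_neg_apply, norm_neg]
      refine (norm_iteratedFDeriv_smul_le ((hsm i).mul (hsm i)) (hb.fderiv.1 i) x (n := n) (by exact_mod_cast le_top)).trans ?_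
      refine Finset.sum_le_sum fun j hj => ?_
      have hl' : j ≤ n := by simpa [Nat.lt_succ_iff] using hj
      have h0 := (norm_nonneg _).trans (hg2 j hl' i x)
      gcongr
      · exact hg2 j hl' i x
      · exact hD _ i x

end

theorem param_bound (a b B : ℝ) (n : ℕ) : ∀ {E F : Type} [NormedAddCommGroup E] [NormedSpace ℝ E]
    [NormedAddCommGroup F] [NormedSpace ℝ F] [FiniteDimensional ℝ E] [CompleteSpace F]
    (Φ : E × ℝ → F) (_ : ContDiff ℝ ∞ Φ)
    (_ : ∀ s x, ‖iteratedFDeriv ℝ n (fun x => Φ (x, s)) x‖ ≤ B) (x : E),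
    ‖iteratedFDeriv ℝ n (fun x => ∫ s in a..b, Φ (x, s)) x‖ ≤ B * |b - a| := by
  induction n with
  | zero =>
    intro E F _ _ _ _ _ _ Φ h hB x
    rw [norm_iteratedFDeriv_zero]
    refine intervalIntegral.norm_integral_le_of_norm_le_const fun s _ => ?_
    simpa using hB s x
  | succ n ih =>
    intro E F _ _ _ _ _ _ Φ h hB x
    rw [← norm_iteratedFDeriv_fderiv]
    have : _root_.fderiv ℝ (fun x => ∫ s in a..b, Φ (x, s)) = fun x =>
        ∫ s in a..b, (fun p : E × ℝ => (_root_.fderiv ℝ Φ p).comp (ContinuousLinearMap.inl ℝ E ℝ)) (x, s) := by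
      funext x
      exact (hasFDerivAt_param a b Φ (h.of_le (by simp)) x).fderiv
    rw [this]
    have hs : ContDiff ℝ ∞ (fun p : E × ℝ => (_root_.fderiv ℝ Φ p).comp (ContinuousLinearMap.inl ℝ E ℝ)) :=
      (h.fderiv_right (by simp)).clm_comp contDiff_const
    refine ih _ hs (fun s x => ?_) x
    have h2 : (fun x => (_root_.fderiv ℝ Φ (x, s)).comp (ContinuousLinearMap.inl ℝ E ℝ)) =
        _root_.fderiv ℝ (fun x => Φ (x, s)) := by
      funext x
      have h0 : HasFDerivAt (fun x : E => (x, s)) (ContinuousLinearMap.inl ℝ E ℝ) x :=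
        (hasFDerivAt_id (𝕜 := ℝ) x).prodMk (hasFDerivAt_const s x)
      have h1 := HasFDerivAt.comp (g := Φ) x (h.differentiable (by simp) (x, s)).hasFDerivAt h0
      exact h1.fderiv.symm
    simp only [h2]
    rw [norm_iteratedFDeriv_fderiv]
    exact hB s x

theorem UB.integral {ι E F : Type} [NormedAddCommGroup E] [NormedSpace ℝ E]
    [NormedAddCommGroup F] [NormedSpace ℝ F] [FiniteDimensional ℝ E] [CompleteSpace F]
    (a b : ℝ) (Φ : ι → E × ℝ → F) (hs : ∀ i, ContDiff ℝ ∞ (Φ i))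
    (h : UB (fun (p : ι × ℝ) x => Φ p.1 (x, p.2))) :
    UB (fun i x => ∫ s in a..b, Φ i (x, s)) := by
  refine ⟨fun i => contDiff_param a b _ (hs i), fun n => ?_⟩
  obtain ⟨C, hC⟩ := h.2 n
  exact ⟨C * |b - a|, fun i x => param_bound a b C n (Φ i) (hs i) (fun s x => hC (i, s) x) x⟩

theorem UB.of_compactSupport {ι E F : Type} [NormedAddCommGroup E] [NormedSpace ℝ E]
    [NormedAddCommGroup F] [NormedSpace ℝ F] (f : E → F) (hf : ContDiff ℝ ∞ f) (hc : HasCompactSupport f) :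
    UB (fun (_ : ι) => f) := by
  refine ⟨fun _ => hf, fun n => ?_⟩
  obtain ⟨C, hC⟩ := (hf.continuous_iteratedFDeriv (m := n) (by exact_mod_cast le_top)).bounded_above_of_compact_support (hc.iteratedFDeriv n)
  exact ⟨C, fun _ x => hC x⟩

/-- precomposition with a fixed linear map of norm at most one -/
theorem UB.comp_clm {ι E E' F : Type} [NormedAddCommGroup E] [NormedSpace ℝ E]
    [NormedAddCommGroup E'] [NormedSpace ℝ E'] [NormedAddCommGroup F] [NormedSpace ℝ F]
    {e : ι → E → F} (he : UB e) (L : E' →L[ℝ] E) : UB (fun i x => e i (L x)) := by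
  refine ⟨fun i => (he.1 i).comp L.contDiff, fun n => ?_⟩
  obtain ⟨C, hC⟩ := he.2 n
  refine ⟨C * ‖L‖ ^ n, fun i x => ?_⟩
  have := L.iteratedFDeriv_comp_right (he.1 i) x (i := n) (by exact_mod_cast le_top)
  change ‖iteratedFDeriv ℝ n (e i ∘ L) x‖ ≤ _
  rw [this]
  refine (ContinuousMultilinearMap.norm_compContinuousLinearMap_le _ _).trans ?_
  simp only [Finset.prod_const, Finset.card_univ, Fintype.card_fin]
  gcongr
  exact hC i _

/-- precomposition with translations -/
theorem UB.comp_sub {ι E F : Type} [NormedAddCommGroup E] [NormedSpace ℝ E]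
    [NormedAddCommGroup F] [NormedSpace ℝ F]
    {e : ι → E → F} (he : UB e) (c : ι → E) : UB (fun i x => e i (x - c i)) := by
  refine ⟨fun i => (he.1 i).comp (contDiff_id.sub contDiff_const), fun n => ?_⟩
  obtain ⟨C, hC⟩ := he.2 n
  refine ⟨C, fun i x => ?_⟩
  rw [iteratedFDeriv_comp_sub]
  exact hC _ _

end Mond

open Filter Topology
open scoped ContDiff
namespace Mond
open Real in
theorem angle_cauchy (f : ℂ → ℂ) (hf : Differentiable ℂ f) (c a : ℂ) (R : ℝ) (ha : a ∈ Metric.ball c R) :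
    ∫ θ in (0:ℝ)..2 * π, circleMap 0 R θ * ((circleMap c R θ - a)⁻¹ * f (circleMap c R θ)) = 2 * π * f a := by
  have h := hf.diffContOnCl.circleIntegral_sub_inv_smul (c := c) (R := R) ha
  rw [circleIntegral] at h
  simp only [deriv_circleMap, smul_eq_mul] at h
  have h2 : ∀ θ, circleMap 0 R θ * Complex.I * ((circleMap c R θ - a)⁻¹ * f (circleMap c R θ)) =
    Complex.I * (circleMap 0 R θ * ((circleMap c R θ - a)⁻¹ * f (circleMap c R θ))) := fun θ => by ring
  simp only [h2, intervalIntegral.integral_const_mul] at h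
  have : Complex.I ≠ 0 := Complex.I_ne_zero
  apply mul_left_cancel₀ this
  rw [h]; ring

theorem angle_cont (f : ℂ → ℂ) (hf : Differentiable ℂ f) (c a : ℂ) (R : ℝ) (ha : a ∈ Metric.ball c R) :
    Continuous fun θ => circleMap 0 R θ * ((circleMap c R θ - a)⁻¹ * f (circleMap c R θ)) := by
  have h1 : ∀ θ, circleMap c R θ - a ≠ 0 := by
    intro θ h0
    rw [sub_eq_zero] at h0
    exact circleMap_ne_mem_ball ha θ h0
  exact (continuous_circleMap 0 R).mul ((((continuous_circleMap c R).sub continuous_const).inv₀ h1).mul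
    (hf.continuous.comp (continuous_circleMap c R)))

open Real in
theorem jouk_int (k : ℕ) (ρ : ℝ) (hρ : 1 < ρ) (X : ℝ) (hX : |X| ≤ 1) :
    ∫ θ in (0:ℝ)..2 * π, (((circleMap 0 ρ θ)^(k+1) * (1 - ((circleMap 0 ρ θ)⁻¹)^2) / 2) /
      ((circleMap 0 ρ θ + (circleMap 0 ρ θ)⁻¹)/2 - X)) =
      2 * π * (2 * (Polynomial.Chebyshev.T ℂ k).eval (X:ℂ) - 0 ^ k) := by
  obtain ⟨hX1, hX2⟩ := abs_le.1 hX
  set φ : ℝ := Real.arccos X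
  have hXφ : (X : ℂ) = Complex.cos φ := by
    rw [← Complex.ofReal_cos, Real.cos_arccos hX1 hX2]
  set a : ℂ := Complex.exp (φ * Complex.I) with ha
  set b : ℂ := Complex.exp (-φ * Complex.I) with hb
  have hab : a * b = 1 := by rw [ha, hb, ← Complex.exp_add]; simp
  have hsum : a + b = 2 * X := by rw [hXφ, Complex.cos]; ring
  have hna : ‖a‖ = 1 := by rw [ha, Complex.norm_exp_ofReal_mul_I]
  have hnb : ‖b‖ = 1 := by
    have := congrArg norm hab
    rwa [norm_mul, hna, one_mul, norm_one] at this
  have haB : a ∈ Metric.ball (0:ℂ) ρ := by simp [hna, hρ]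
  have hbB : b ∈ Metric.ball (0:ℂ) ρ := by simp [hnb, hρ]
  have h0B : (0:ℂ) ∈ Metric.ball (0:ℂ) ρ := by simp; linarith
  have hd : Differentiable ℂ (fun z : ℂ => z ^ k) := by fun_prop
  have key : ∀ θ, (((circleMap 0 ρ θ)^(k+1) * (1 - ((circleMap 0 ρ θ)⁻¹)^2) / 2) /
      ((circleMap 0 ρ θ + (circleMap 0 ρ θ)⁻¹)/2 - X)) =
      circleMap 0 ρ θ * ((circleMap 0 ρ θ - a)⁻¹ * (circleMap 0 ρ θ)^k) +
      circleMap 0 ρ θ * ((circleMap 0 ρ θ - b)⁻¹ * (circleMap 0 ρ θ)^k) -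
      circleMap 0 ρ θ * ((circleMap 0 ρ θ - 0)⁻¹ * (circleMap 0 ρ θ)^k) := by
    intro θ
    have e1 : circleMap 0 ρ θ - a ≠ 0 := fun h => circleMap_ne_mem_ball haB θ (sub_eq_zero.1 h)
    have e2 : circleMap 0 ρ θ - b ≠ 0 := fun h => circleMap_ne_mem_ball hbB θ (sub_eq_zero.1 h)
    have e3 : circleMap 0 ρ θ ≠ 0 := fun h => circleMap_ne_mem_ball h0B θ h
    generalize circleMap 0 ρ θ = w at *
    have e4 : (w + w⁻¹)/2 - X = (w - a) * (w - b) / (2 * w) := by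
      field_simp
      linear_combination hsum * w - hab
    rw [e4, sub_zero]
    field_simp
    linear_combination (w^(k+1))*hab
  simp only [key]
  rw [intervalIntegral.integral_sub, intervalIntegral.integral_add,
    angle_cauchy _ hd 0 a ρ haB, angle_cauchy _ hd 0 b ρ hbB, angle_cauchy _ hd 0 0 ρ h0B]
  · have : (Polynomial.Chebyshev.T ℂ k).eval (X:ℂ) = (a^k + b^k)/2 := by
      rw [hXφ, Polynomial.Chebyshev.T_complex_cos, Complex.cos, ha, hb, ← Complex.exp_nat_mul, ← Complex.exp_nat_mul]
      simp only [Int.cast_natCast]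
      ring_nf
    rw [this]; ring
  · exact (angle_cont _ hd 0 a ρ haB).intervalIntegrable _ _
  · exact (angle_cont _ hd 0 b ρ hbB).intervalIntegrable _ _
  · exact ((angle_cont _ hd 0 a ρ haB).add (angle_cont _ hd 0 b ρ hbB)).intervalIntegrable _ _
  · exact (angle_cont _ hd 0 0 ρ h0B).intervalIntegrable _ _

theorem cheb_bound (k : ℕ) (z : ℂ) (hre : |z.re| ≤ 3/4) (him : |z.im| ≤ 1/(2*(k+1))) :
    ‖(Polynomial.Chebyshev.T ℂ k).eval z‖ ≤ 3 := by
  obtain ⟨w, rfl⟩ := Complex.cos_surjective z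
  rw [Polynomial.Chebyshev.T_complex_cos]
  obtain ⟨α, β, rfl⟩ : ∃ α β : ℝ, w = α + β * Complex.I := ⟨w.re, w.im, (Complex.re_add_im w).symm⟩
  have hc : Complex.cos (α + β * Complex.I) = (Real.cos α * Real.cosh β : ℝ) - (Real.sin α * Real.sinh β : ℝ) * Complex.I := by
    rw [Complex.cos_add_mul_I]; push_cast; ring
  rw [hc] at hre him
  simp [-Complex.ofReal_mul, -Complex.ofReal_cos, -Complex.ofReal_sin] at hre him
  have h1 : |Real.cos α| ≤ 3/4 := by
    refine le_trans ?_ hre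
    have := Real.one_le_cosh β
    rw [abs_of_nonneg (by linarith : 0 ≤ Real.cosh β)]
    nlinarith [abs_nonneg (Real.cos α)]
  have h2 : 1/2 ≤ |Real.sin α| := by
    have h3 := Real.sin_sq_add_cos_sq α
    by_contra! h4
    have := abs_nonneg (Real.sin α)
    have := abs_nonneg (Real.cos α)
    nlinarith [sq_abs (Real.sin α), sq_abs (Real.cos α)]
  have hk : (0:ℝ) < k + 1 := by positivity
  have h3 : |Real.sinh β| ≤ 1/(k+1) := by
    have e : ((k:ℝ)+1)⁻¹ * 2⁻¹ = 1/2 * (1/(k+1)) := by field_simp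
    rw [e] at him
    have := abs_nonneg (Real.sinh β)
    nlinarith
  have h4 : |β| ≤ 1/(k+1) := by
    refine le_trans ?_ h3
    rw [Real.abs_sinh]
    exact Real.self_le_sinh_iff.2 (abs_nonneg _)
  have h5 : k * |β| ≤ 1 := by
    have : (k:ℝ) * |β| ≤ k * (1/(k+1)) := by gcongr
    refine this.trans ?_
    rw [mul_one_div, div_le_one hk]; linarith
  have h6 : ‖Complex.cos ((k:ℤ) * (α + β * Complex.I))‖ ≤ Real.exp (k * |β|) := by
    rw [Complex.cos]
    rw [norm_div, Complex.norm_two, div_le_iff₀ (by norm_num)]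
    refine (norm_add_le _ _).trans ?_
    rw [Complex.norm_exp, Complex.norm_exp]
    have a1 : (((k:ℤ):ℂ) * (α + β * Complex.I) * Complex.I).re ≤ k * |β| := by
      simp
      nlinarith [neg_abs_le β, (Nat.cast_nonneg k : (0:ℝ) ≤ k)]
    have a2 : (-(((k:ℤ):ℂ) * (α + β * Complex.I)) * Complex.I).re ≤ k * |β| := by
      simp
      nlinarith [le_abs_self β, (Nat.cast_nonneg k : (0:ℝ) ≤ k)]
    have := Real.exp_le_exp.2 a1
    have := Real.exp_le_exp.2 a2
    linarith
  refine h6.trans ?_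
  refine (Real.exp_le_exp.2 h5).trans ?_
  have := Real.exp_one_lt_d9
  linarith

end Mond

open Filter Topology
open scoped ContDiff
namespace Mond

theorem jouk_eq (ρ θ : ℝ) : (circleMap 0 ρ θ + (circleMap 0 ρ θ)⁻¹)/2 =
    ((ρ + ρ⁻¹)/2 * Real.cos θ : ℝ) + ((ρ - ρ⁻¹)/2 * Real.sin θ : ℝ) * Complex.I := by
  have h : (circleMap 0 ρ θ)⁻¹ = ρ⁻¹ * Complex.exp (-(θ * Complex.I)) := by
    simp [circleMap, Complex.exp_neg, mul_comm]
  rw [h]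
  simp only [circleMap, zero_add]
  rw [← neg_mul, Complex.exp_mul_I, Complex.exp_mul_I, Complex.cos_neg, Complex.sin_neg]
  push_cast
  ring

theorem jouk_dist (K θ : ℝ) (hK : 1 ≤ K) (z : ℂ) (hz : ‖z‖ ≤ 1/2) (him : |z.im| ≤ 1/K) :
    1/(4*K) ≤ ‖(circleMap 0 (1+8/K) θ + (circleMap 0 (1+8/K) θ)⁻¹)/2 - z‖ := by
  have hK0 : 0 < K := by linarith
  set ρ := 1 + 8/K with hρ
  have hq : 0 < 8/K := by positivity
  have hρ1 : 1 < ρ := by linarith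
  have hi : 0 < ρ⁻¹ := by positivity
  have hi1 : ρ⁻¹ < 1 := inv_lt_one_of_one_lt₀ hρ1
  have hρi : ρ * ρ⁻¹ = 1 := mul_inv_cancel₀ (by linarith)
  rw [jouk_eq]
  set ζ : ℂ := ((ρ + ρ⁻¹)/2 * Real.cos θ : ℝ) + ((ρ - ρ⁻¹)/2 * Real.sin θ : ℝ) * Complex.I with hζ
  have hre : ζ.re = (ρ + ρ⁻¹)/2 * Real.cos θ := by simp [hζ, -Complex.ofReal_mul, -Complex.ofReal_cos, -Complex.ofReal_sin]
  have himζ : ζ.im = (ρ - ρ⁻¹)/2 * Real.sin θ := by simp [hζ, -Complex.ofReal_mul, -Complex.ofReal_cos, -Complex.ofReal_sin]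
  have hzre : |z.re| ≤ 1/2 := (Complex.abs_re_le_norm z).trans hz
  have hsc := Real.sin_sq_add_cos_sq θ
  by_cases hs : 1/2 ≤ |Real.sin θ|
  · have h1 : 2/K ≤ |ζ.im| := by
      rw [himζ, abs_mul, abs_of_pos (by linarith)]
      have : 4/K ≤ (ρ - ρ⁻¹)/2 := by
        have e : 8/K = ρ - 1 := by rw [hρ]; ring
        have e2 : 4/K = (ρ-1)/2 := by rw [← e]; ring
        rw [e2]; linarith
      have h3 : 2/K = 4/K * (1/2) := by ring
      rw [h3]
      have : 0 < 4/K := by positivity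
      gcongr
      linarith
    have h2 := Complex.abs_im_le_norm (ζ - z)
    rw [Complex.sub_im] at h2
    have h3 := abs_sub_abs_le_abs_sub ζ.im z.im
    have h4 : 1/(4*K) ≤ 1/K := by
      apply one_div_le_one_div_of_le hK0; linarith
    have h5 : 2/K = 1/K + 1/K := by ring
    linarith
  · push Not at hs
    have hc : 3/4 ≤ |Real.cos θ| := by
      by_contra! h4
      have := abs_nonneg (Real.sin θ)
      have := abs_nonneg (Real.cos θ)
      nlinarith [sq_abs (Real.sin θ), sq_abs (Real.cos θ)]
    have h1 : 3/4 ≤ |ζ.re| := by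
      rw [hre, abs_mul, abs_of_pos (by linarith)]
      have : 1 ≤ (ρ + ρ⁻¹)/2 := by nlinarith [sq_nonneg (ρ - 1), sq_nonneg (1-ρ⁻¹)]
      nlinarith
    have h2 := Complex.abs_re_le_norm (ζ - z)
    rw [Complex.sub_re] at h2
    have h3 := abs_sub_abs_le_abs_sub ζ.re z.re
    have h4 : 1/(4*K) ≤ 1/4 := by
      apply one_div_le_one_div_of_le (by norm_num); linarith
    linarith

theorem root_bound (v y : ℝ) (hv : |v| ≤ 1/20) (hy : |y| ≤ 1/20) (z : ℂ) (h : z^3 + v*z^2 - y = 0) :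
    ‖z‖ ≤ 1/2 := by
  by_contra! h1
  have h2 : z^3 = y - v * z^2 := by linear_combination h
  have h3 := congrArg norm h2
  rw [norm_pow] at h3
  have h4 := norm_sub_le (y:ℂ) (v * z^2)
  rw [← h3, norm_mul, norm_pow, Complex.norm_real, Complex.norm_real, Real.norm_eq_abs, Real.norm_eq_abs] at h4
  have h5 : |v| * ‖z‖^2 ≤ 1/20 * ‖z‖^2 := by gcongr
  nlinarith [sq_nonneg ‖z‖]

theorem contDiff_circleMap' (c : ℂ) (R : ℝ) : ContDiff ℝ ∞ (circleMap c R) := contDiff_circleMap c R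

theorem local_contour (k : ℕ) (v0 y0 : ℝ) (hv : |v0| ≤ 1/20) (hy : |y0| ≤ 1/20) :
    ∃ ζ μ : ℝ → ℂ, ContDiff ℝ ∞ ζ ∧ ContDiff ℝ ∞ μ ∧ (∀ θ, ‖ζ θ‖ ≤ 5) ∧ (∀ θ, ‖μ θ‖ ≤ 20 * Real.exp 8) ∧
    (∀ θ, 1/(64 * ((k:ℝ)+1)^3) ≤ ‖ζ θ ^ 3 + v0 * ζ θ ^ 2 - y0‖) ∧
    ∀ v y X : ℝ, |v - v0| ≤ 1/(8*((k:ℝ)+1)^3) → |y - y0| ≤ 1/(8*((k:ℝ)+1)^3) → X^3 + v*X^2 = y → |X| ≤ 1/2 →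
      ∫ θ in (0:ℝ)..2*Real.pi, μ θ / (ζ θ - X) = (Polynomial.Chebyshev.T ℂ k).eval (X:ℂ) := by
  obtain ⟨t, ht⟩ : ∃ t : ℝ, t^3 + v0 * t^2 - y0 = 0 := by
    have hc : Continuous fun t : ℝ => t^3 + v0*t^2 - y0 := by fun_prop
    obtain ⟨v1, v2⟩ := abs_le.1 hv
    obtain ⟨y1, y2⟩ := abs_le.1 hy
    exact mem_range_of_exists_le_of_exists_ge hc ⟨-1, by norm_num; linarith⟩ ⟨1, by norm_num; linarith⟩
  set K : ℝ := k + 1 with hK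
  have hK1 : 1 ≤ K := by rw [hK]; simp
  have hK0 : 0 < K := by linarith
  set b := t + v0 with hb
  set q := t * b - b^2/4 with hq
  have hfac : ∀ z : ℂ, z^3 + v0 * z^2 - y0 = (z - t) * ((z + b/2)^2 + q) := by
    intro z
    have ht' : (t:ℂ)^3 + v0 * t^2 - y0 = 0 := by exact_mod_cast ht
    rw [hq, hb]; push_cast
    linear_combination ht'
  have htn : ‖(t:ℂ)‖ ≤ 1/2 := root_bound v0 y0 hv hy t (by rw [hfac]; simp)
  have htn' : |t| ≤ 1/2 := by simpa using htn
  by_cases hqK : q ≤ 1/K^2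
  · -- all roots are near the real axis
    obtain ⟨s, hs, hsi⟩ : ∃ s : ℂ, s^2 = -q ∧ |s.im| ≤ 1/K := by
      rcases le_total q 0 with h | h
      · refine ⟨(Real.sqrt (-q) : ℝ), ?_, ?_⟩
        · rw [← Complex.ofReal_pow, Real.sq_sqrt (by linarith)]; simp
        · simp [hK0.le]
      · refine ⟨(Real.sqrt q : ℝ) * Complex.I, ?_, ?_⟩
        · rw [mul_pow, ← Complex.ofReal_pow, Real.sq_sqrt h]; simp
        · simp only [Complex.mul_I_im, Complex.ofReal_re]
          rw [abs_of_nonneg (Real.sqrt_nonneg _)]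
          refine Real.sqrt_le_iff.2 ⟨by positivity, ?_⟩
          rw [div_pow, one_pow]; exact hqK
    have hfac2 : ∀ z : ℂ, z^3 + v0 * z^2 - y0 = (z - t) * (z - (-(b/2) + s)) * (z - (-(b/2) - s)) := by
      intro z
      rw [hfac]
      linear_combination (z-t)*hs
    set z1 : ℂ := -(b/2) + s with hz1
    set z2 : ℂ := -(b/2) - s with hz2
    have n1 : ‖z1‖ ≤ 1/2 := root_bound v0 y0 hv hy z1 (by rw [hfac2]; simp)
    have n2 : ‖z2‖ ≤ 1/2 := root_bound v0 y0 hv hy z2 (by rw [hfac2]; simp)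
    have i1 : |z1.im| ≤ 1/K := by
      have : z1.im = s.im := by rw [hz1]; simp
      rw [this]; exact hsi
    have i2 : |z2.im| ≤ 1/K := by
      have : z2.im = -s.im := by rw [hz2]; simp
      rw [this, abs_neg]; exact hsi
    have i0 : |(t:ℂ).im| ≤ 1/K := by simp [hK0.le]
    set ρ := 1 + 8/K with hρ
    have hρ1 : 1 < ρ := by have : 0 < 8/K := by positivity
                           linarith
    have hρ9 : ρ ≤ 9 := by
      have : 8/K ≤ 8 := div_le_self (by norm_num) hK1
      linarith
    have hρk : ρ^k ≤ Real.exp 8 := by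
      have h1 : ρ ≤ Real.exp (8/K) := by rw [hρ, add_comm]; exact Real.add_one_le_exp _
      calc ρ^k ≤ (Real.exp (8/K))^k := by gcongr
        _ = Real.exp (k * (8/K)) := by rw [← Real.exp_nat_mul]
        _ ≤ Real.exp 8 := by
          apply Real.exp_le_exp.2
          rw [← mul_div_assoc, div_le_iff₀ hK0, hK]; linarith
    have hw0 : ∀ θ, circleMap 0 ρ θ ≠ 0 := fun θ => circleMap_ne_center (by linarith)
    have hwn : ∀ θ, ‖circleMap 0 ρ θ‖ = ρ := fun θ => by simp [abs_of_pos (by linarith : 0 < ρ)]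
    have hwi : ∀ θ, ‖(circleMap 0 ρ θ)⁻¹‖ ≤ 1 := fun θ => by
      rw [norm_inv, hwn]; exact inv_le_one_of_one_le₀ hρ1.le
    set c : ℂ := Complex.ofReal ((if k = 0 then 2 else 1 : ℝ) / (4*Real.pi)) with hc
    have hcn : ‖c‖ ≤ 1 := by
      rw [hc, Complex.norm_real, Real.norm_eq_abs, abs_of_nonneg (by positivity), div_le_one (by positivity)]
      have := Real.pi_gt_three
      split_ifs <;> linarith
    have hsm := contDiff_circleMap' 0 ρ
    refine ⟨fun θ => (circleMap 0 ρ θ + (circleMap 0 ρ θ)⁻¹)/2,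
      fun θ => c * (((circleMap 0 ρ θ)^(k+1) * (1 - ((circleMap 0 ρ θ)⁻¹)^2) / 2)), ?_, ?_, ?_, ?_, ?_, ?_⟩
    · exact (hsm.add (hsm.inv hw0)).div_const _
    · exact contDiff_const.mul (((hsm.pow _).mul (contDiff_const.sub ((hsm.inv hw0).pow 2))).div_const _)
    · intro θ
      rw [norm_div, Complex.norm_two, div_le_iff₀ (by norm_num)]
      refine (norm_add_le _ _).trans ?_
      have := hwi θ
      rw [hwn]; linarith
    · intro θ
      rw [norm_mul, norm_div, norm_mul, norm_pow, hwn, Complex.norm_two]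
      have h1 : ‖1 - ((circleMap 0 ρ θ)⁻¹)^2‖ ≤ 2 := by
        refine (norm_sub_le _ _).trans ?_
        rw [norm_one, norm_pow]
        have := hwi θ
        nlinarith [norm_nonneg (circleMap 0 ρ θ)⁻¹]
      have h2 : ρ^(k+1) ≤ Real.exp 8 * 9 := by rw [pow_succ]; gcongr
      have h3 := Real.exp_pos 8
      calc ‖c‖ * (ρ^(k+1) * ‖1 - ((circleMap 0 ρ θ)⁻¹)^2‖ / 2) ≤ 1 * (Real.exp 8 * 9 * 2 / 2) := by gcongr
        _ ≤ 20 * Real.exp 8 := by linarith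
    · intro θ
      have d0 := jouk_dist K θ hK1 t htn i0
      have d1 := jouk_dist K θ hK1 z1 n1 i1
      have d2 := jouk_dist K θ hK1 z2 n2 i2
      rw [hfac2, norm_mul, norm_mul]
      have e : 1/(64*K^3) = 1/(4*K) * (1/(4*K)) * (1/(4*K)) := by field_simp; norm_num
      rw [e]
      have hp : 0 ≤ 1/(4*K) := by positivity
      gcongr
    · intro v y X _ _ _ hX
      have h1 := jouk_int k ρ hρ1 X (by linarith)
      simp only [mul_div_assoc c]
      rw [intervalIntegral.integral_const_mul, h1, hc]
      have hpi : (Real.pi:ℂ) ≠ 0 := by exact_mod_cast Real.pi_ne_zero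
      rcases Nat.eq_zero_or_pos k with rfl | hk
      · simp
        field_simp
        norm_num
      · rw [if_neg (by omega), zero_pow (by omega)]
        push_cast
        field_simp
        ring
  · -- only one root near the real axis
    push Not at hqK
    have hR0 : 0 < 1/(2*K) := by positivity
    set R := 1/(2*K) with hR
    have hRle : R ≤ 1/2 := by
      rw [hR]; apply one_div_le_one_div_of_le (by norm_num); linarith
    have hcm : ∀ θ, circleMap (t:ℂ) R θ = t + circleMap 0 R θ := fun θ => by simp [circleMap]
    have hcn : ∀ θ, ‖circleMap 0 R θ‖ = R := fun θ => by simp [abs_of_pos hR0]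
    have hsq : Real.sqrt q > 1/K := by
      apply Real.lt_sqrt_of_sq_lt
      rw [div_pow, one_pow]; exact hqK
    have hq0 : 0 ≤ q := le_trans (by positivity) hqK.le
    have hT : Differentiable ℂ fun z => (Polynomial.Chebyshev.T ℂ k).eval z := Polynomial.differentiable _
    have him : ∀ θ, |(circleMap (t:ℂ) R θ).im| ≤ R := by
      intro θ
      rw [hcm]
      have := Complex.abs_im_le_norm (circleMap 0 R θ)
      rw [hcn] at this
      simpa using! this
    have hTb : ∀ θ, ‖(Polynomial.Chebyshev.T ℂ k).eval (circleMap (t:ℂ) R θ)‖ ≤ 3 := by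
      intro θ
      rcases Nat.eq_zero_or_pos k with rfl | hk
      · simp
      · apply cheb_bound
        · have hK2 : 2 ≤ K := by
            have : (1:ℝ) ≤ k := by exact_mod_cast hk
            rw [hK]; linarith
          have hR4 : R ≤ 1/4 := by
            rw [hR]; apply one_div_le_one_div_of_le (by norm_num); linarith
          have h1 := Complex.abs_re_le_norm (circleMap (t:ℂ) R θ)
          have h2 := norm_add_le (t:ℂ) (circleMap 0 R θ)
          rw [← hcm, hcn] at h2
          linarith
        · exact him θ
    refine ⟨circleMap t R, fun θ => (1/(2*Real.pi) : ℝ) * (circleMap 0 R θ * (Polynomial.Chebyshev.T ℂ k).eval (circleMap (t:ℂ) R θ)), contDiff_circleMap' _ _, ?_, ?_, ?_, ?_, ?_⟩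
    · refine contDiff_const.mul ((contDiff_circleMap' _ _).mul ?_)
      exact (hT.contDiff.restrict_scalars ℝ).comp (contDiff_circleMap' _ _)
    · intro θ
      have h2 := norm_add_le (t:ℂ) (circleMap 0 R θ)
      rw [← hcm, hcn] at h2
      linarith
    · intro θ
      rw [norm_mul, norm_mul, hcn, Complex.norm_real, Real.norm_eq_abs, abs_of_pos (by positivity)]
      have h1 : 1/(2*Real.pi) ≤ 1 := by
        rw [div_le_one (by positivity)]; have := Real.pi_gt_three; linarith
      calc _ ≤ 1 * (1/2 * 3) := by gcongr; exact hTb θ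
        _ ≤ 20 * Real.exp 8 := by have := Real.add_one_le_exp (8:ℝ); linarith
    · intro θ
      set ζ := circleMap (t:ℂ) R θ with hζ
      have hs : ((Real.sqrt q : ℝ):ℂ)^2 = q := by exact_mod_cast Real.sq_sqrt hq0
      have hfac2 : (ζ + b/2)^2 + q = (ζ - (-(b/2) + (Real.sqrt q:ℝ) * Complex.I)) * (ζ - (-(b/2) - (Real.sqrt q:ℝ) * Complex.I)) := by
        linear_combination (-1)*hs + ((Real.sqrt q : ℝ):ℂ)^2 * Complex.I_sq
      rw [hfac, norm_mul, hfac2, norm_mul]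
      have h0 : ‖ζ - t‖ = R := by rw [hζ, hcm]; simpa using! hcn θ
      have hi := abs_le.1 (him θ)
      have hRK : 1/K = R + R := by rw [hR]; field_simp; norm_num
      have h1 : R ≤ ‖ζ - (-(b/2) + (Real.sqrt q:ℝ) * Complex.I)‖ := by
        refine le_trans ?_ (Complex.abs_im_le_norm _)
        simp
        refine le_trans ?_ (neg_le_abs _)
        linarith [hi.1, hi.2]
      have h2 : R ≤ ‖ζ - (-(b/2) - (Real.sqrt q:ℝ) * Complex.I)‖ := by
        refine le_trans ?_ (Complex.abs_im_le_norm _)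
        simp
        refine le_trans ?_ (le_abs_self _)
        linarith [hi.1, hi.2]
      rw [h0]
      have e : 1/(64*K^3) ≤ R * (R * R) := by
        have : R * (R*R) = 1/(8*K^3) := by rw [hR]; field_simp; norm_num
        rw [this]
        apply one_div_le_one_div_of_le (by positivity)
        have : 0 < K^3 := by positivity
        linarith
      refine e.trans ?_
      gcongr
    · intro v y X hvv hyy hXr hX
      have hXin : (X:ℂ) ∈ Metric.ball (t:ℂ) R := by
        rw [Metric.mem_ball, dist_eq_norm, ← Complex.ofReal_sub, Complex.norm_real, Real.norm_eq_abs]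
        have h1 : (X - t) * ((X + b/2)^2 + q) = (v0 - v)*X^2 + (y - y0) := by
          have := hfac X
          have h2 : X^3 + v0 * X^2 - y0 = (X - t) * ((X + b/2)^2 + q) := by exact_mod_cast this
          linear_combination hXr - h2
        have h3 := congrArg abs h1
        rw [abs_mul] at h3
        have h4 : |(v0 - v)*X^2 + (y - y0)| ≤ 1/(8*K^3) * 1 + 1/(8*K^3) := by
          refine (abs_add_le _ _).trans ?_
          rw [abs_mul]
          gcongr
          · rw [abs_sub_comm]; exact hvv
          · rw [abs_pow]; nlinarith [abs_nonneg X]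
        have h5 : 1/K^2 ≤ |(X+b/2)^2 + q| := by
          refine le_trans ?_ (le_abs_self _)
          nlinarith [sq_nonneg (X+b/2)]
        have h6 : |X - t| * (1/K^2) ≤ 1/(8*K^3) * 1 + 1/(8*K^3) := by
          calc _ ≤ |X - t| * |(X+b/2)^2 + q| := by gcongr
            _ ≤ _ := by rw [h3]; exact h4
        have e : 1/(8*K^3) * 1 + 1/(8*K^3) = 1/(4*K) * (1/K^2) := by field_simp; norm_num
        rw [e] at h6
        have h7 : |X - t| ≤ 1/(4*K) := le_of_mul_le_mul_right h6 (by positivity)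
        refine lt_of_le_of_lt h7 ?_
        rw [hR]; apply one_div_lt_one_div_of_lt (by positivity); linarith
      have h1 := angle_cauchy _ hT t X R hXin
      have h2 : ∀ θ, ((1/(2*Real.pi) : ℝ):ℂ) * (circleMap 0 R θ * (Polynomial.Chebyshev.T ℂ k).eval (circleMap (t:ℂ) R θ)) / (circleMap t R θ - X) =
         ((1/(2*Real.pi) : ℝ):ℂ) * (circleMap 0 R θ * ((circleMap t R θ - X)⁻¹ * (Polynomial.Chebyshev.T ℂ k).eval (circleMap (t:ℂ) R θ))) := by
        intro θ; ring
      simp only [h2]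
      rw [intervalIntegral.integral_const_mul, h1]
      have hpi : (Real.pi:ℂ) ≠ 0 := by exact_mod_cast Real.pi_ne_zero
      push_cast
      field_simp

end Mond

open Filter Topology
open scoped ContDiff
namespace Mond

noncomputable def kap (x : ℝ) : ℝ := x * (Real.smoothTransition (x + 2) * Real.smoothTransition (2 - x))

noncomputable def psi (x : ℝ) : ℝ := Real.smoothTransition (x + 1) - Real.smoothTransition x

theorem st_smooth : ContDiff ℝ ∞ Real.smoothTransition := Real.smoothTransition.contDiff

theorem kap_smooth : ContDiff ℝ ∞ kap :=
  contDiff_id.mul ((st_smooth.comp (contDiff_id.add contDiff_const)).mul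
    (st_smooth.comp (contDiff_const.sub contDiff_id)))

theorem psi_smooth : ContDiff ℝ ∞ psi :=
  (st_smooth.comp (contDiff_id.add contDiff_const)).sub st_smooth

theorem kap_zero {x : ℝ} (hx : 2 < |x|) : kap x = 0 := by
  unfold kap
  rcases lt_abs.1 hx with h | h
  · rw [Real.smoothTransition.zero_of_nonpos (x := 2 - x) (by linarith)]; simp
  · rw [Real.smoothTransition.zero_of_nonpos (x := x + 2) (by linarith)]; simp

theorem kap_id {x : ℝ} (hx : |x| ≤ 1) : kap x = x := by
  unfold kap
  obtain ⟨h1, h2⟩ := abs_le.1 hx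
  rw [Real.smoothTransition.one_of_one_le (x := 2 - x) (by linarith),
    Real.smoothTransition.one_of_one_le (x := x + 2) (by linarith)]; simp

theorem kap_le (x : ℝ) : |kap x| ≤ 2 := by
  by_cases hx : 2 < |x|
  · rw [kap_zero hx]; simp
  · push Not at hx
    unfold kap
    have a1 := Real.smoothTransition.le_one (x+2)
    have a2 := Real.smoothTransition.nonneg (x+2)
    have a3 := Real.smoothTransition.le_one (2-x)
    have a4 := Real.smoothTransition.nonneg (2-x)
    rw [abs_mul, abs_of_nonneg (mul_nonneg a2 a4)]
    have : Real.smoothTransition (x + 2) * Real.smoothTransition (2 - x) ≤ 1 := mul_le_one₀ a1 a4 a3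
    nlinarith [mul_nonneg a2 a4, abs_nonneg x]

theorem psi_zero {x : ℝ} (hx : 1 < |x|) : psi x = 0 := by
  unfold psi
  rcases lt_abs.1 hx with h | h
  · rw [Real.smoothTransition.one_of_one_le (x := x) (by linarith),
      Real.smoothTransition.one_of_one_le (x := x + 1) (by linarith)]; simp
  · rw [Real.smoothTransition.zero_of_nonpos (x := x) (by linarith),
      Real.smoothTransition.zero_of_nonpos (x := x + 1) (by linarith)]; simp

theorem psi_sum (J : ℕ) (x : ℝ) (hx : |x| ≤ J) :
    ∑ i ∈ Finset.range (2*J+1), psi (x - ((i:ℝ) - J)) = 1 := by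
  have h := Finset.sum_range_sub' (fun i : ℕ => Real.smoothTransition (x - i + J + 1)) (2*J+1)
  obtain ⟨h1, h2⟩ := abs_le.1 hx
  rw [Real.smoothTransition.one_of_one_le (x := x - (0:ℕ) + J + 1) (by push_cast; linarith),
    Real.smoothTransition.zero_of_nonpos (by push_cast; linarith)] at h
  rw [sub_zero] at h
  rw [← h]
  refine Finset.sum_congr rfl fun i _ => ?_
  unfold psi
  push_cast
  congr 2 <;> ring

theorem ofReal_smooth : ContDiff ℝ ∞ (fun x : ℝ => (x : ℂ)) := Complex.ofRealCLM.contDiff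

theorem UB.kap {ι : Type} : UB (fun (_ : ι) (x : ℝ) => (kap x : ℂ)) := by
  apply UB.of_compactSupport _ (ofReal_smooth.comp kap_smooth)
  refine HasCompactSupport.intro (isCompact_closedBall (0:ℝ) 2) fun x hx => ?_
  simp only [Metric.mem_closedBall, dist_zero_right, Real.norm_eq_abs, not_le] at hx
  simp [kap_zero hx]

theorem UB.psi {ι : Type} : UB (fun (_ : ι) (x : ℝ) => (psi x : ℂ)) := by
  apply UB.of_compactSupport _ (ofReal_smooth.comp psi_smooth)
  refine HasCompactSupport.intro (isCompact_closedBall (0:ℝ) 1) fun x hx => ?_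
  simp only [Metric.mem_closedBall, dist_zero_right, Real.norm_eq_abs, not_le] at hx
  simp [psi_zero hx]

/-- mesh size -/
noncomputable def mesh (k : ℕ) : ℝ := 1/(4000*((k:ℝ)+1)^3)
def gridJ (k : ℕ) : ℕ := 200 * (k+1)^3
noncomputable def cen (k i : ℕ) : ℝ := mesh k * ((min i (2 * gridJ k) : ℕ) - gridJ k)

theorem mesh_pos (k : ℕ) : 0 < mesh k := by unfold mesh; positivity
theorem mesh_le (k : ℕ) : mesh k ≤ 1 := by
  unfold mesh
  rw [div_le_one (by positivity)]
  have : (1:ℝ) ≤ ((k:ℝ)+1)^3 := one_le_pow₀ (by simp)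
  linarith
theorem mesh_grid (k : ℕ) : mesh k * gridJ k = 1/20 := by
  unfold mesh gridJ; push_cast; field_simp; norm_num
theorem cen_le (k i : ℕ) : |cen k i| ≤ 1/20 := by
  unfold cen
  rw [abs_mul, abs_of_pos (mesh_pos k), ← mesh_grid k]
  gcongr
  · exact (mesh_pos k).le
  · rw [abs_le]
    have : ((min i (2 * gridJ k) : ℕ) : ℝ) ≤ (2 * gridJ k : ℕ) := by exact_mod_cast min_le_right _ _
    push_cast at this ⊢
    have h0 : (0:ℝ) ≤ min (i:ℝ) (2 * gridJ k) := by positivity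
    constructor <;> linarith

def polc (l : Fin 3) (z V : ℂ) : ℂ := if l = 0 then z * z + V * z else if l = 1 then z + V else 1

theorem UB.polc {ι : Type} (l : Fin 3) {Z V : ι → ℝ × ℝ → ℂ} (hZ : UB Z) (hV : UB V) :
    UB (fun i p => polc l (Z i p) (V i p)) := by
  unfold Mond.polc
  split_ifs
  · exact (hZ.mul hZ).add (hV.mul hZ)
  · exact hZ.add hV
  · exact UB.const (fun _ => (1:ℂ)) 1 (fun _ => norm_one.le)

theorem contDiff_polc {E : Type} [NormedAddCommGroup E] [NormedSpace ℝ E] (l : Fin 3) {Z V : E → ℂ}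
    (hZ : ContDiff ℝ ∞ Z) (hV : ContDiff ℝ ∞ V) : ContDiff ℝ ∞ (fun p => polc l (Z p) (V p)) := by
  unfold Mond.polc
  split_ifs
  · exact (hZ.mul hZ).add (hV.mul hZ)
  · exact hZ.add hV
  · exact contDiff_const

set_option maxHeartbeats 1000000 in
/-- local coefficients, in rescaled coordinates -/
theorem local_coeffs : ∃ loc : Fin 3 → (ℕ × ℕ × ℕ) → ℝ × ℝ → ℂ, (∀ l, UB (loc l)) ∧
    ∀ k i j (p : ℝ × ℝ) (X : ℝ), |p.1| ≤ 1 → |p.2| ≤ 1 → |X| ≤ 1/2 →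
      X^3 + (cen k i + mesh k * p.1) * X^2 = cen k j + mesh k * p.2 →
      loc 0 (k,i,j) p + loc 1 (k,i,j) p * X + loc 2 (k,i,j) p * X^2 =
        mesh k * (Polynomial.Chebyshev.T ℂ k).eval (X:ℂ) := by
  choose ζ m hζ hm hζb hmb hP hint using fun q : ℕ × ℕ × ℕ =>
    local_contour q.1 (cen q.1 q.2.1) (cen q.1 q.2.2) (cen_le _ _) (cen_le _ _)
  set B : ℝ := 20 * Real.exp 8
  -- the basic pieces
  let a : (ℕ × ℕ × ℕ) × ℝ → ℂ := fun i =>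
    (ζ i.1 i.2 ^ 3 + cen i.1.1 i.1.2.1 * ζ i.1 i.2 ^ 2 - cen i.1.1 i.1.2.2) / mesh i.1.1
  let b : (ℕ × ℕ × ℕ) × ℝ → ℝ × ℝ → ℂ := fun i p => kap p.1 * ζ i.1 i.2 ^ 2 + -(kap p.2)
  let V : (ℕ × ℕ × ℕ) × ℝ → ℝ × ℝ → ℂ := fun i p => cen i.1.1 i.1.2.1 + mesh i.1.1 * kap p.1
  have k1 : UB (fun (_ : (ℕ × ℕ × ℕ) × ℝ) (p : ℝ × ℝ) => (kap p.1 : ℂ)) :=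
    UB.comp_clm UB.kap (ContinuousLinearMap.fst ℝ ℝ ℝ)
  have k2 : UB (fun (_ : (ℕ × ℕ × ℕ) × ℝ) (p : ℝ × ℝ) => (kap p.2 : ℂ)) :=
    UB.comp_clm UB.kap (ContinuousLinearMap.snd ℝ ℝ ℝ)
  have hZ : UB (fun (i : (ℕ × ℕ × ℕ) × ℝ) (_ : ℝ × ℝ) => ζ i.1 i.2) := UB.const _ 5 fun i => hζb _ _
  have hM : UB (fun (i : (ℕ × ℕ × ℕ) × ℝ) (_ : ℝ × ℝ) => m i.1 i.2) := UB.const _ B fun i => hmb _ _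
  have hZ2 : UB (fun (i : (ℕ × ℕ × ℕ) × ℝ) (_ : ℝ × ℝ) => ζ i.1 i.2 ^ 2) := by
    simpa [pow_two] using hZ.mul hZ
  have hb : UB b := (k1.mul hZ2).add k2.neg
  have hV : UB V := by
    refine (UB.const _ (1/20) fun i => ?_).add ((UB.const _ 1 fun i => ?_).mul k1)
    · rw [Complex.norm_real]; exact cen_le _ _
    · rw [Complex.norm_real, Real.norm_eq_abs, abs_of_pos (mesh_pos _)]; exact mesh_le _
  have hab : ∀ i p, 1 ≤ ‖a i + b i p‖ := by
    intro i p
    have h1 : 60 ≤ ‖a i‖ := by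
      simp only [a]
      rw [norm_div, Complex.norm_real, Real.norm_eq_abs, abs_of_pos (mesh_pos _), le_div_iff₀ (mesh_pos _)]
      refine le_trans ?_ (hP i.1 i.2)
      unfold mesh
      have : (0:ℝ) < ((i.1.1:ℝ)+1)^3 := by positivity
      rw [mul_one_div, div_le_div_iff₀ (by positivity) (by positivity)]
      linarith
    have h2 : ‖b i p‖ ≤ 2 * 5^2 + 2 := by
      simp only [b]
      refine (norm_add_le _ _).trans ?_
      rw [norm_neg, norm_mul, norm_pow, Complex.norm_real, Complex.norm_real]
      have := hζb i.1 i.2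
      gcongr
      · exact kap_le _
      · exact kap_le _
    have := norm_sub_le_norm_add (a i) (b i p)
    linarith
  have hab0 : ∀ i p, a i + b i p ≠ 0 := fun i p h => by
    have := hab i p; rw [h] at this; norm_num at this
  have hinv := hb.inv a hab
  have hpol : ∀ l, UB (fun (i : (ℕ × ℕ × ℕ) × ℝ) p => polc l (ζ i.1 i.2) (V i p)) := fun l => UB.polc l hZ hV
  let Φ : Fin 3 → (ℕ × ℕ × ℕ) → (ℝ × ℝ) × ℝ → ℂ := fun l i x =>
    m i x.2 * (polc l (ζ i x.2) (V (i, x.2) x.1) * (a (i, x.2) + b (i, x.2) x.1)⁻¹)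
  have sζ : ∀ i, ContDiff ℝ ∞ (fun x : (ℝ × ℝ) × ℝ => ζ i x.2) := fun i => (hζ i).comp contDiff_snd
  have sm : ∀ i, ContDiff ℝ ∞ (fun x : (ℝ × ℝ) × ℝ => m i x.2) := fun i => (hm i).comp contDiff_snd
  have sk1 : ContDiff ℝ ∞ (fun x : (ℝ × ℝ) × ℝ => (kap x.1.1 : ℂ)) :=
    ofReal_smooth.comp (kap_smooth.comp (contDiff_fst.comp contDiff_fst))
  have sk2 : ContDiff ℝ ∞ (fun x : (ℝ × ℝ) × ℝ => (kap x.1.2 : ℂ)) :=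
    ofReal_smooth.comp (kap_smooth.comp (contDiff_snd.comp contDiff_fst))
  have sV : ∀ i, ContDiff ℝ ∞ (fun x : (ℝ × ℝ) × ℝ => V (i, x.2) x.1) := fun i =>
    show ContDiff ℝ ∞ (fun x : (ℝ × ℝ) × ℝ => (cen i.1 i.2.1 : ℂ) + (mesh i.1 : ℂ) * (kap x.1.1 : ℂ)) from
    contDiff_const.add (contDiff_const.mul sk1)
  have sa : ∀ i, ContDiff ℝ ∞ (fun x : (ℝ × ℝ) × ℝ => a (i, x.2)) := fun i => by
    have h1 := (sζ i).pow 3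
    have h2 := (contDiff_const (c := (cen i.1 i.2.1 : ℂ))).mul ((sζ i).pow 2)
    have h3 := (h1.add h2).sub (contDiff_const (c := (cen i.1 i.2.2 : ℂ)))
    exact h3.mul (contDiff_const (c := ((mesh i.1 : ℂ))⁻¹))
  have sb : ∀ i, ContDiff ℝ ∞ (fun x : (ℝ × ℝ) × ℝ => b (i, x.2) x.1) := fun i =>
    (sk1.mul ((sζ i).pow 2)).add sk2.neg
  have sab : ∀ i, ContDiff ℝ ∞ (fun x : (ℝ × ℝ) × ℝ => a (i, x.2) + b (i, x.2) x.1) := fun i => (sa i).add (sb i)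
  have spol : ∀ l i, ContDiff ℝ ∞ (fun x : (ℝ × ℝ) × ℝ => polc l (ζ i x.2) (V (i, x.2) x.1)) :=
    fun l i => contDiff_polc l (sζ i) (sV i)
  have sΦ : ∀ l i, ContDiff ℝ ∞ (Φ l i) := fun l i =>
    (sm i).mul ((spol l i).mul ((sab i).inv fun x => hab0 _ _))
  refine ⟨fun l i p => ∫ θ in (0:ℝ)..2*Real.pi, Φ l i (p, θ), fun l => ?_, ?_⟩
  · exact UB.integral _ _ (Φ l) (sΦ l) (hM.mul ((hpol l).mul hinv))
  · intro k i j p X hp1 hp2 hX hroot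
    have hI : ∀ l, IntervalIntegrable (fun θ => Φ l (k,i,j) (p, θ)) MeasureTheory.volume 0 (2*Real.pi) := fun l =>
      ((sΦ l (k,i,j)).continuous.comp (Continuous.prodMk continuous_const continuous_id)).intervalIntegrable _ _
    rw [← intervalIntegral.integral_mul_const, ← intervalIntegral.integral_mul_const,
      ← intervalIntegral.integral_add (hI 0) ((hI 1).mul_const _),
      ← intervalIntegral.integral_add ((hI 0).add ((hI 1).mul_const _)) ((hI 2).mul_const _)]
    have hmesh := mesh_pos k
    have hml : mesh k ≤ 1/(8*((k:ℝ)+1)^3) := by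
      unfold mesh
      apply one_div_le_one_div_of_le (by positivity)
      have : (0:ℝ) < ((k:ℝ)+1)^3 := by positivity
      linarith
    have h1 := hint (k,i,j) (cen k i + mesh k * p.1) (cen k j + mesh k * p.2) X
      (by simp only [add_sub_cancel_left]
          rw [abs_mul, abs_of_pos hmesh]; exact (mul_le_of_le_one_right hmesh.le hp1).trans hml)
      (by simp only [add_sub_cancel_left]
          rw [abs_mul, abs_of_pos hmesh]; exact (mul_le_of_le_one_right hmesh.le hp2).trans hml)
      hroot hX
    simp only at h1
    rw [← h1, ← intervalIntegral.integral_const_mul]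
    refine intervalIntegral.integral_congr fun θ _ => ?_
    have hne := hab0 ((k,i,j),θ) p
    have q0 : ∀ z V, polc 0 z V = z*z + V*z := fun z V => by simp [polc]
    have q1 : ∀ z V, polc 1 z V = z + V := fun z V => by simp [polc]
    have q2 : ∀ z V, polc 2 z V = 1 := fun z V => by simp [polc]
    simp only [Φ, q0, q1, q2, a, b, V, kap_id hp1, kap_id hp2] at hne ⊢
    generalize ζ (k,i,j) θ = z at *
    generalize m (k,i,j) θ = w at *
    have hmc : (mesh k : ℂ) ≠ 0 := by exact_mod_cast hmesh.ne'
    have hrc : (X:ℂ)^3 + (cen k i + mesh k * p.1) * X^2 = cen k j + mesh k * p.2 := by exact_mod_cast hroot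
    have hfac : (z^3 + cen k i * z^2 - cen k j)/mesh k + (p.1 * z^2 + -p.2) =
       (z - X) * ((z^2 + (cen k i + mesh k * p.1) * z) + (z + (cen k i + mesh k * p.1)) * X + X^2) / mesh k := by
      field_simp
      linear_combination hrc
    rw [hfac] at hne ⊢
    have n1 : z - X ≠ 0 := by rintro h; rw [h] at hne; simp at hne
    have n2 : ((z^2 + (cen k i + mesh k * p.1) * z) + (z + (cen k i + mesh k * p.1)) * X + X^2) ≠ 0 := by
      rintro h; rw [h] at hne; simp at hne
    generalize hD : ((z^2 + (cen k i + mesh k * p.1) * z) + (z + (cen k i + mesh k * p.1)) * X + (X:ℂ)^2) = D at *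
    field_simp
    linear_combination w * hD

end Mond

open Filter Topology
open scoped ContDiff
namespace Mond

theorem keyK : ∃ (C : ℕ → ℝ) (N : ℕ → ℕ), ∃ a : ℕ → Fin 3 → ℝ × ℝ → ℂ, 
    (∀ k l, ContDiff ℝ ∞ (a k l)) ∧
    (∀ k l n x, ‖iteratedFDeriv ℝ n (a k l) x‖ ≤ C n * ((k:ℝ)+1)^(N n)) ∧
    ∀ k (v X : ℝ), |v| ≤ 1/20 → |X| ≤ 1/20 →
      a k 0 (v, X^3+v*X^2) + a k 1 (v, X^3+v*X^2) * X + a k 2 (v, X^3+v*X^2) * X^2 =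
        (Polynomial.Chebyshev.T ℂ k).eval (X:ℂ) := by
  obtain ⟨loc, hloc, hid⟩ := local_coeffs
  let G : Fin 3 → (ℕ × ℕ × ℕ) → ℝ × ℝ → ℂ := fun l q p => ((psi p.1 : ℂ) * (psi p.2 : ℂ)) * loc l q p
  have hG : ∀ l, UB (G l) := fun l =>
    ((UB.comp_clm UB.psi (ContinuousLinearMap.fst ℝ ℝ ℝ)).mul
      (UB.comp_clm UB.psi (ContinuousLinearMap.snd ℝ ℝ ℝ))).mul (hloc l)
  let c : (ℕ × ℕ × ℕ) → ℝ × ℝ := fun q => ((q.2.1:ℝ) - gridJ q.1, (q.2.2:ℝ) - gridJ q.1)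
  let H : Fin 3 → (ℕ × ℕ × ℕ) → ℝ × ℝ → ℂ := fun l q p => G l q (p - c q)
  have hH : ∀ l, UB (H l) := fun l => (hG l).comp_sub c
  let S : ℕ → Finset (ℕ × ℕ) := fun k => Finset.range (2 * gridJ k + 1) ×ˢ Finset.range (2 * gridJ k + 1)
  let A : ℕ → Fin 3 → ℝ × ℝ → ℂ := fun k l p => ∑ q ∈ S k, H l (k, q) p
  have sA : ∀ k l, ContDiff ℝ ∞ (A k l) := fun k l => ContDiff.sum fun q _ => (hH l).1 (k, q)
  choose D hD using fun n l => (hH l).2 n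
  have bA : ∀ k l n x, ‖iteratedFDeriv ℝ n (A k l) x‖ ≤ (S k).card * D n l := by
    intro k l n x
    have := congrFun (iteratedFDeriv_sum (𝕜 := ℝ) (u := S k) (i := n) (f := fun q => H l (k, q))
      fun q _ => ((hH l).1 (k,q)).of_le (by exact_mod_cast le_top)) x
    simp only [A]
    rw [this, Finset.sum_apply]
    refine (norm_sum_le _ _).trans ?_
    rw [← nsmul_eq_mul]
    exact Finset.sum_le_card_nsmul _ _ _ fun q _ => hD n l (k, q) x
  let a : ℕ → Fin 3 → ℝ × ℝ → ℂ := fun k l p => ((mesh k)⁻¹ : ℝ) • A k l ((mesh k)⁻¹ • p)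
  have sAs : ∀ k l, ContDiff ℝ ∞ (fun p => A k l ((mesh k)⁻¹ • p)) := fun k l =>
    ContDiff.comp (g := A k l) (f := fun p : ℝ × ℝ => (mesh k)⁻¹ • p) (sA k l) (contDiff_id.const_smul _)
  refine ⟨fun n => 4000^(n+1) * 401^2 * ∑ l, |D n l|, fun n => 3 * (n+1) + 6, a, ?_, ?_, ?_⟩
  · intro k l
    exact (sAs k l).const_smul ((mesh k)⁻¹ : ℝ)
  · intro k l n x
    simp only [a]
    change ‖iteratedFDeriv ℝ n (((mesh k)⁻¹ : ℝ) • fun p => A k l ((mesh k)⁻¹ • p)) x‖ ≤ _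
    rw [iteratedFDeriv_const_smul_apply (((sAs k l).of_le (by exact_mod_cast le_top)).contDiffAt),
      iteratedFDeriv_comp_const_smul _ ((sA k l).of_le (by exact_mod_cast le_top)), norm_smul, norm_smul,
      norm_pow, norm_inv, Real.norm_eq_abs, abs_of_pos (mesh_pos k)]
    have hm : (mesh k)⁻¹ = 4000 * ((k:ℝ)+1)^3 := by unfold mesh; simp
    rw [hm]
    have hcard : ((S k).card : ℝ) ≤ (401 * ((k:ℝ)+1)^3)^2 := by
      simp only [S, Finset.card_product, Finset.card_range, gridJ]
      push_cast
      have : (1:ℝ) ≤ ((k:ℝ)+1)^3 := one_le_pow₀ (by simp)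
      nlinarith
    have hDn : D n l ≤ ∑ l, |D n l| := (le_abs_self _).trans
      (Finset.single_le_sum (f := fun l => |D n l|) (fun _ _ => abs_nonneg _) (Finset.mem_univ l))
    have hS0 : 0 ≤ ∑ l, |D n l| := Finset.sum_nonneg fun _ _ => abs_nonneg _
    calc _ ≤ 4000 * ((k:ℝ)+1)^3 * ((4000 * ((k:ℝ)+1)^3)^n * ((401 * ((k:ℝ)+1)^3)^2 * ∑ l, |D n l|)) := by
          gcongr
          refine (bA k l n _).trans ?_
          exact (mul_le_mul_of_nonneg_left hDn (by positivity)).trans (mul_le_mul_of_nonneg_right hcard hS0)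
      _ = _ := by rw [mul_pow, mul_pow, ← pow_mul, ← pow_mul]; ring
  · intro k v X hv hX
    have hm := mesh_pos k
    have hmJ := mesh_grid k
    set y := X^3 + v*X^2 with hy
    have hyb : |y| ≤ 1/20 := by
      rw [hy]
      refine (abs_add_le _ _).trans ?_
      rw [abs_mul, abs_pow, abs_pow]
      have h2 : |X|^2 ≤ (1/20)^2 := by gcongr
      have h3 : |X|^3 ≤ (1/20)^3 := by gcongr
      nlinarith [abs_nonneg v, sq_nonneg |X|]
    have sc : ∀ z : ℝ, |z| ≤ 1/20 → |(mesh k)⁻¹ * z| ≤ gridJ k := by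
      intro z hz
      rw [abs_mul, abs_of_pos (inv_pos.2 hm), inv_mul_le_iff₀ hm, hmJ]; exact hz
    have hs1 := psi_sum (gridJ k) ((mesh k)⁻¹ * v) (sc v hv)
    have hs2 := psi_sum (gridJ k) ((mesh k)⁻¹ * y) (sc y hyb)
    have hterm : ∀ q ∈ S k, H 0 (k,q) ((mesh k)⁻¹ • (v,y)) + H 1 (k,q) ((mesh k)⁻¹ • (v,y)) * X + H 2 (k,q) ((mesh k)⁻¹ • (v,y)) * X^2 =
        (psi ((mesh k)⁻¹ * v - ((q.1:ℝ) - gridJ k)) : ℂ) * (psi ((mesh k)⁻¹ * y - ((q.2:ℝ) - gridJ k)) : ℂ) *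
          (mesh k * (Polynomial.Chebyshev.T ℂ k).eval (X:ℂ)) := by
      rintro ⟨i, j⟩ hq
      simp only [S, Finset.mem_product, Finset.mem_range] at hq
      simp only [H, G, c, Prod.smul_mk, smul_eq_mul, Prod.mk_sub_mk]
      by_cases h1 : 1 < |(mesh k)⁻¹ * v - ((i:ℝ) - gridJ k)|
      · rw [psi_zero h1]; simp
      by_cases h2 : 1 < |(mesh k)⁻¹ * y - ((j:ℝ) - gridJ k)|
      · rw [psi_zero h2]; simp
      push Not at h1 h2
      have hc1 : cen k i = mesh k * (i - gridJ k) := by unfold cen; rw [min_eq_left (by omega)]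
      have hc2 : cen k j = mesh k * (j - gridJ k) := by unfold cen; rw [min_eq_left (by omega)]
      have := hid k i j ((mesh k)⁻¹ * v - ((i:ℝ) - gridJ k), (mesh k)⁻¹ * y - ((j:ℝ) - gridJ k)) X h1 h2 (by linarith)
        (by simp only [hc1, hc2]
            have e : ∀ z g : ℝ, mesh k * g + mesh k * ((mesh k)⁻¹ * z - g) = z := fun z g => by field_simp; ring
            rw [e, e])
      rw [← this]
      ring
    have hsum := Finset.sum_congr rfl hterm
    rw [Finset.sum_add_distrib, Finset.sum_add_distrib, ← Finset.sum_mul, ← Finset.sum_mul, ← Finset.sum_mul] at hsum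
    have hprod : ∑ q ∈ S k, (psi ((mesh k)⁻¹ * v - ((q.1:ℝ) - gridJ k)) : ℂ) * (psi ((mesh k)⁻¹ * y - ((q.2:ℝ) - gridJ k)) : ℂ) = 1 := by
      simp only [S]
      rw [Finset.sum_product]
      simp only
      rw [← Finset.sum_mul_sum]
      rw [← Complex.ofReal_sum, ← Complex.ofReal_sum, hs1, hs2]; simp
    rw [hprod, one_mul] at hsum
    have hmc : (mesh k : ℂ) ≠ 0 := by exact_mod_cast hm.ne'
    simp only [a, A, Complex.real_smul, Complex.ofReal_inv]
    have key : ∀ M P Q R x e : ℂ, M ≠ 0 → P + Q * x + R * x^2 = M * e → 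
        M⁻¹ * P + M⁻¹ * Q * x + M⁻¹ * R * x^2 = e := by
      intro M P Q R x e hM h
      have : M⁻¹ * P + M⁻¹ * Q * x + M⁻¹ * R * x^2 = M⁻¹ * (P + Q * x + R * x^2) := by ring
      rw [this, h, inv_mul_cancel_left₀ hM]
    exact key _ _ _ _ _ _ hmc hsum

end Mond

open Filter Topology
open scoped ContDiff
namespace Mond

/-- smooth functions of `(v, θ)`, periodic in `θ`, supported in `|v| ≤ 1` -/
structure PS (h : ℝ × ℝ → ℂ) : Prop where
  smooth : ContDiff ℝ ∞ h
  per : ∀ v s, h (v, s + 2 * Real.pi) = h (v, s)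
  supp : ∀ v s, 1 < |v| → h (v, s) = 0

/-- oscillating factor -/
noncomputable def osc (k : ℤ) (s : ℝ) : ℂ := Complex.exp (-(Complex.I * k * s))

/-- (unnormalised) Fourier coefficient -/
noncomputable def FI (k : ℤ) (h : ℝ × ℝ → ℂ) (v : ℝ) : ℂ := ∫ s in (0:ℝ)..(2 * Real.pi), osc k s * h (v, s)

theorem osc_smooth (k : ℤ) : ContDiff ℝ ∞ (osc k) := by
  unfold osc
  have := ofReal_smooth
  exact Complex.contDiff_exp.comp ((contDiff_const.mul this).neg)

theorem osc_norm (k : ℤ) (s : ℝ) : ‖osc k s‖ = 1 := by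
  unfold osc
  have : -(Complex.I * k * s) = ((-(k * s) : ℝ) : ℂ) * Complex.I := by push_cast; ring
  rw [this, Complex.norm_exp_ofReal_mul_I]

theorem FI_UB {h : ℝ × ℝ → ℂ} (hh : PS h) : UB (fun k : ℤ => FI k h) := by
  let χ : ContDiffBump (0:ℝ) := ⟨10, 11, by norm_num, by norm_num⟩
  let G : ℝ × ℝ → ℂ := fun p => (χ p.2 : ℂ) * h p
  have sχ : ContDiff ℝ ∞ (fun s : ℝ => ((χ s : ℝ) : ℂ)) := ofReal_smooth.comp χ.contDiff
  have sG : ContDiff ℝ ∞ G := (sχ.comp contDiff_snd).mul hh.smooth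
  have cG : HasCompactSupport G := by
    refine HasCompactSupport.intro (K := Metric.closedBall (0:ℝ×ℝ) 11) (isCompact_closedBall _ _) ?_
    rintro ⟨v, s⟩ hp
    simp only [G]
    by_cases hv : 1 < |v|
    · rw [hh.supp v s hv, mul_zero]
    · have : χ s = 0 := by
        apply χ.zero_of_le_dist
        simp only [Metric.mem_closedBall, dist_zero_right, Prod.norm_def, sup_le_iff, Real.norm_eq_abs, not_and_or] at hp
        push Not at hp hv
        simp only [dist_zero_right, Real.norm_eq_abs, χ]
        rcases hp with hp | hp <;> linarith
      rw [this]; simp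
  have e : (fun k : ℤ => FI k h) = fun k v => ∫ s in (0:ℝ)..(2 * Real.pi), (fun p : ℝ × ℝ => osc k p.2 * G p) (v, s) := by
    funext k v
    unfold FI
    refine intervalIntegral.integral_congr fun s hs => ?_
    rw [Set.uIcc_of_le (by positivity)] at hs
    have : χ s = 1 := by
      apply χ.one_of_mem_closedBall
      simp only [Metric.mem_closedBall, dist_zero_right, Real.norm_eq_abs, χ]
      rw [abs_of_nonneg hs.1]; linarith [hs.2, Real.pi_lt_four]
    simp only [G, this]; simp
  rw [e]
  refine UB.integral _ _ (fun k => fun p : ℝ × ℝ => osc k p.2 * G p) (fun k => ((osc_smooth k).comp contDiff_snd).mul sG) ?_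
  have h1 : UB (fun (p : ℤ × ℝ) (x : ℝ) => osc p.1 p.2) := UB.const _ 1 fun p => (osc_norm _ _).le
  have h2 : UB (fun (_ : ℤ × ℝ) => G) := UB.of_compactSupport G sG cG
  have h3 := ((h2.comp_sub (fun p : ℤ × ℝ => ((0:ℝ), -p.2)))).comp_clm (ContinuousLinearMap.inl ℝ ℝ ℝ)
  have h4 := h1.mul h3
  convert h4 using 4 with p x
  simp

/-- derivative in the angle -/
noncomputable def dth (h : ℝ × ℝ → ℂ) : ℝ × ℝ → ℂ := fun p => fderiv ℝ h p (0, 1)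

theorem dth_hasDerivAt {h : ℝ × ℝ → ℂ} (hh : ContDiff ℝ ∞ h) (v s : ℝ) :
    HasDerivAt (fun s => h (v, s)) (dth h (v, s)) s := by
  have h0 : HasDerivAt (fun s : ℝ => (v, s)) ((0:ℝ), (1:ℝ)) s := (hasDerivAt_const s v).prodMk (hasDerivAt_id s)
  exact HasFDerivAt.comp_hasDerivAt s (hh.differentiable (by simp) (v, s)).hasFDerivAt h0

theorem PS.dth {h : ℝ × ℝ → ℂ} (hh : PS h) : PS (dth h) := by
  refine ⟨?_, ?_, ?_⟩
  · exact (hh.smooth.fderiv_right (by simp)).clm_apply contDiff_const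
  · intro v s
    have h1 := (dth_hasDerivAt hh.smooth v (s + 2 * Real.pi)).comp_add_const
    simp only [hh.per] at h1
    exact h1.unique (dth_hasDerivAt hh.smooth v s)
  · intro v s hv
    have h1 := dth_hasDerivAt hh.smooth v s
    have e : (fun s => h (v, s)) = fun _ => 0 := by funext s; exact hh.supp v s hv
    rw [e] at h1
    exact h1.unique (hasDerivAt_const s _)

theorem FI_dth {h : ℝ × ℝ → ℂ} (hh : PS h) (k : ℤ) (v : ℝ) : FI k (dth h) v = Complex.I * k * FI k h v := by
  have hd : ∀ s, HasDerivAt (fun s => osc k s * h (v, s))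
      (-(Complex.I * k) * osc k s * h (v, s) + osc k s * dth h (v, s)) s := by
    intro s
    refine HasDerivAt.mul ?_ (dth_hasDerivAt hh.smooth v s)
    unfold osc
    have h1 : HasDerivAt (fun s : ℝ => -(Complex.I * k * (s:ℂ))) (-(Complex.I * k * 1)) s :=
      ((HasDerivAt.ofReal_comp (hasDerivAt_id s)).const_mul _).neg
    have h2 := h1.cexp
    have h3 : -(Complex.I * k) * Complex.exp (-(Complex.I * k * s)) = Complex.exp (-(Complex.I * k * s)) * -(Complex.I * k * 1) := by ring
    rw [h3]; exact h2
  have co := (osc_smooth k).continuous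
  have ch : Continuous fun s => h (v, s) := hh.smooth.continuous.comp (by fun_prop)
  have cd : Continuous fun s => dth h (v, s) := hh.dth.smooth.continuous.comp (by fun_prop)
  have c1 : Continuous fun s => -(Complex.I * k) * osc k s * h (v, s) := (continuous_const.mul co).mul ch
  have c2 : Continuous fun s => osc k s * dth h (v, s) := co.mul cd
  have hI := intervalIntegral.integral_eq_sub_of_hasDerivAt (a := 0) (b := 2 * Real.pi) (fun s _ => hd s)
    ((c1.add c2).intervalIntegrable _ _)
  rw [intervalIntegral.integral_add (c1.intervalIntegrable _ _) (c2.intervalIntegrable _ _)] at hI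
  simp only [mul_assoc (-(Complex.I * k))] at hI
  rw [intervalIntegral.integral_const_mul] at hI
  have e1 : osc k (2 * Real.pi) = osc k 0 := by
    unfold osc
    have : -(Complex.I * k * ((2 * Real.pi : ℝ) : ℂ)) = ((-k : ℤ) : ℂ) * (2 * Real.pi * Complex.I) := by push_cast; ring
    rw [this, Complex.exp_int_mul_two_pi_mul_I]; simp
  have e2 : h (v, 2 * Real.pi) = h (v, 0) := by simpa using hh.per v 0
  rw [e1, e2, sub_self] at hI
  unfold FI
  linear_combination hI

theorem FI_pow {h : ℝ × ℝ → ℂ} (hh : PS h) (M : ℕ) : ∃ h', PS h' ∧ ∀ k v, FI k h' v = (Complex.I * k)^M * FI k h v := by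
  induction M with
  | zero => exact ⟨h, hh, by simp⟩
  | succ M ih =>
    obtain ⟨h', h1, h2⟩ := ih
    refine ⟨_, h1.dth, fun k v => ?_⟩
    rw [FI_dth h1, h2, pow_succ]; ring

theorem FI_decay {h : ℝ × ℝ → ℂ} (hh : PS h) (M n : ℕ) : ∃ C, ∀ (k : ℤ) v,
    ‖iteratedFDeriv ℝ n (FI k h) v‖ * ((k.natAbs:ℝ)+1)^M ≤ C := by
  obtain ⟨h', h1, h2⟩ := FI_pow hh M
  obtain ⟨C0, hC0⟩ := (FI_UB hh).2 n
  obtain ⟨C1, hC1⟩ := (FI_UB h1).2 n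
  refine ⟨2^(M-1) * (C1 + C0), fun k v => ?_⟩
  have e : FI k h' = (Complex.I * k)^M • FI k h := by funext v; rw [h2]; rfl
  have h3 : ‖iteratedFDeriv ℝ n (FI k h') v‖ ≤ C1 := hC1 k v
  rw [e, iteratedFDeriv_const_smul_apply (((FI_UB hh).1 k).of_le (by exact_mod_cast le_top)).contDiffAt, norm_smul, norm_pow] at h3
  have e3 : ‖Complex.I * (k:ℂ)‖ = (k.natAbs:ℝ) := by simp [Nat.cast_natAbs]
  rw [e3] at h3
  have h4 := add_pow_le (Nat.cast_nonneg (α := ℝ) k.natAbs) zero_le_one M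
  calc _ ≤ ‖iteratedFDeriv ℝ n (FI k h) v‖ * (2^(M-1) * ((k.natAbs:ℝ)^M + 1^M)) := by gcongr
    _ = 2^(M-1) * ((k.natAbs:ℝ)^M * ‖iteratedFDeriv ℝ n (FI k h) v‖ + ‖iteratedFDeriv ℝ n (FI k h) v‖) := by ring
    _ ≤ _ := by gcongr; exact hC0 k v

theorem summable_int_inv : Summable (fun k : ℤ => ((((k.natAbs:ℝ)+1)^2)⁻¹)) := by
  have hN : Summable (fun k : ℕ => ((((k:ℝ)+1)^2)⁻¹)) := by
    have := (summable_nat_add_iff 1).2 (Real.summable_nat_pow_inv.2 (by norm_num : 1 < 2))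
    simpa using this
  exact Summable.of_nat_of_neg (by simpa using hN) (by simpa using hN)

theorem FI_sum {h : ℝ × ℝ → ℂ} (hh : PS h) (v θ : ℝ) :
    HasSum (fun k : ℤ => ((2 * Real.pi)⁻¹ : ℂ) * FI k h v * Complex.exp (Complex.I * k * θ)) (h (v, θ)) := by
  have : Fact (0 < 2 * Real.pi) := ⟨Real.two_pi_pos⟩
  have hper : Function.Periodic (fun s => h (v, s)) (2 * Real.pi) := fun s => hh.per v s
  have hcont : Continuous (hper.lift) := continuous_coinduced_dom.2 (by
    exact hh.smooth.continuous.comp (by fun_prop : Continuous fun s : ℝ => (v, s)))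
  let F : C(AddCircle (2 * Real.pi), ℂ) := ⟨hper.lift, hcont⟩
  have hF : ∀ s : ℝ, F (s : AddCircle (2 * Real.pi)) = h (v, s) := fun s => hper.lift_coe s
  have hc : ∀ k : ℤ, fourierCoeff F k = ((2 * Real.pi)⁻¹ : ℂ) * FI k h v := by
    intro k
    rw [fourierCoeff_eq_intervalIntegral _ _ 0]
    simp only [hF, zero_add, fourier_coe_apply]
    rw [Complex.real_smul]
    congr 1
    · push_cast; simp
    · unfold FI
      refine intervalIntegral.integral_congr fun s _ => ?_
      simp only [osc, smul_eq_mul]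
      congr 2
      have := Real.pi_ne_zero
      push_cast
      field_simp
  have hsum : Summable (fourierCoeff F) := by
    obtain ⟨C, hC⟩ := FI_decay hh 2 0
    refine Summable.of_norm_bounded (g := fun k : ℤ => (‖((2 * Real.pi)⁻¹ : ℂ)‖ * C) * ((((k.natAbs:ℝ)+1)^2)⁻¹)) (summable_int_inv.mul_left _) fun k => ?_
    rw [hc, norm_mul, mul_assoc]
    gcongr
    have := hC k v
    rw [norm_iteratedFDeriv_zero] at this
    rwa [← div_eq_mul_inv, le_div_iff₀ (by positivity)]
  have := has_pointwise_sum_fourier_series_of_summable hsum (θ : AddCircle (2 * Real.pi))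
  rw [hF] at this
  convert this using 2 with k
  rw [hc, fourier_coe_apply, smul_eq_mul]
  congr 2
  have := Real.pi_ne_zero
  push_cast
  field_simp

theorem cheb_series (f : ℝ × ℝ → ℝ) (hf : ContDiff ℝ ∞ f) : ∃ c : ℤ → ℝ → ℂ, (∀ k, ContDiff ℝ ∞ (c k)) ∧
    (∀ M n : ℕ, ∃ C, ∀ (k : ℤ) v, ‖iteratedFDeriv ℝ n (c k) v‖ * ((k.natAbs:ℝ)+1)^M ≤ C) ∧
    ∀ v X : ℝ, |v| ≤ 1/20 → |X| ≤ 1/20 →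
      HasSum (fun k : ℤ => c k v * (Polynomial.Chebyshev.T ℂ (k.natAbs:ℤ)).eval (X:ℂ)) (f (v, X)) := by
  let χ : ContDiffBump (0:ℝ) := ⟨1/2, 1, by norm_num, by norm_num⟩
  let h : ℝ × ℝ → ℂ := fun p => ((χ p.1 * f (p.1, Real.cos p.2) : ℝ) : ℂ)
  have hps : PS h := by
    refine ⟨?_, ?_, ?_⟩
    · have h1 : ContDiff ℝ ∞ (fun p : ℝ × ℝ => χ p.1) := χ.contDiff.comp contDiff_fst
      have h2 : ContDiff ℝ ∞ (fun p : ℝ × ℝ => f (p.1, Real.cos p.2)) := hf.comp (by fun_prop)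
      exact ofReal_smooth.comp (h1.mul h2)
    · intro v s; simp [h]
    · intro v s hv
      have : χ v = 0 := χ.zero_of_le_dist (by simpa [χ] using hv.le)
      simp [h, this]
  let w : ℂ := ((2 * Real.pi)⁻¹ : ℂ)
  refine ⟨fun k => w • FI k h, fun k => ((FI_UB hps).1 k).const_smul w, fun M n => ?_, fun v X hv hX => ?_⟩
  · obtain ⟨C, hC⟩ := FI_decay hps M n
    refine ⟨‖w‖ * C, fun k v => ?_⟩
    rw [iteratedFDeriv_const_smul_apply (((FI_UB hps).1 k).of_le (by exact_mod_cast le_top)).contDiffAt, norm_smul, mul_assoc]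
    gcongr
    exact hC k v
  · have hX' := abs_le.1 hX
    set θ := Real.arccos X with hθ
    have hcos : Real.cos θ = X := Real.cos_arccos (by linarith) (by linarith)
    have hχ : χ v = 1 := χ.one_of_mem_closedBall (by simp [χ]; linarith)
    have s1 := FI_sum hps v θ
    have s2 := FI_sum hps v (-θ)
    have v1 : h (v, θ) = f (v, X) := by simp [h, hcos, hχ]
    have v2 : h (v, -θ) = f (v, X) := by simp [h, hcos, hχ]
    rw [v1] at s1
    rw [v2] at s2
    have s3 := (s1.add s2).mul_left (1/2 : ℂ)
    have e0 : ((f (v, X) : ℝ) : ℂ) = 1/2 * ((f (v, X) : ℝ) + (f (v, X) : ℝ)) := by ring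
    rw [e0]
    have e3 : (fun k : ℤ => (w • FI k h) v * (Polynomial.Chebyshev.T ℂ (k.natAbs:ℤ)).eval (X:ℂ)) = fun k : ℤ =>
        (1/2 : ℂ) * (((2 * Real.pi)⁻¹ : ℂ) * FI k h v * Complex.exp (Complex.I * k * θ) +
          ((2 * Real.pi)⁻¹ : ℂ) * FI k h v * Complex.exp (Complex.I * k * (-θ : ℝ))) := by
      funext k
      have : (Polynomial.Chebyshev.T ℂ (k.natAbs:ℤ)).eval (X:ℂ) = Complex.cos (k * θ) := by
        rw [← hcos, Complex.ofReal_cos, Polynomial.Chebyshev.T_natAbs, Polynomial.Chebyshev.T_complex_cos]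
      rw [this, Complex.cos]
      simp only [Pi.smul_apply, smul_eq_mul, w]
      have e1 : (k:ℂ) * θ * Complex.I = Complex.I * k * θ := by ring
      have e2 : -((k:ℂ) * θ) * Complex.I = Complex.I * k * (-θ:ℝ) := by push_cast; ring
      rw [e1, e2]
      ring
    rw [e3]
    exact s3

end Mond

open Filter Topology
open scoped ContDiff
namespace Mond

/-- The division theorem (Malgrange preparation) for the fold-type map `(v, X) ↦ (v, X^3 + v X^2)`. -/
theorem malgrange (f : ℝ × ℝ → ℝ) (hf : ContDiff ℝ ∞ f) : ∃ a : Fin 3 → ℝ × ℝ → ℝ,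
    (∀ l, ContDiff ℝ ∞ (a l)) ∧
    ∀ v X : ℝ, |v| ≤ 1/20 → |X| ≤ 1/20 → f (v, X) = a 0 (v, X^3+v*X^2) + a 1 (v, X^3+v*X^2) * X + a 2 (v, X^3+v*X^2) * X^2 := by
  obtain ⟨c, sc, bc, hc⟩ := cheb_series f hf
  obtain ⟨C, N, a, sa, ba, ha⟩ := keyK
  let F : Fin 3 → ℤ → ℝ × ℝ → ℂ := fun l k p => c k p.1 * a k.natAbs l p
  have scf : ∀ k, ContDiff ℝ ∞ (fun p : ℝ × ℝ => c k p.1) := fun k => (sc k).comp contDiff_fst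
  have sF : ∀ l k, ContDiff ℝ ∞ (F l k) := fun l k => (scf k).mul (sa _ l)
  choose D hD using bc
  have C0 : ∀ n, 0 ≤ C n := by
    intro n
    have := (norm_nonneg _).trans (ba 0 0 n 0)
    simpa using this
  have D0 : ∀ M n, 0 ≤ D M n := fun M n => le_trans (by positivity) (hD M n 0 0)
  have bcf : ∀ k j p, ‖iteratedFDeriv ℝ j (fun p : ℝ × ℝ => c k p.1) p‖ ≤ ‖iteratedFDeriv ℝ j (c k) p.1‖ := by
    intro k j p
    have := (ContinuousLinearMap.fst ℝ ℝ ℝ).iteratedFDeriv_comp_right (sc k) p (i := j) (by exact_mod_cast le_top)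
    change ‖iteratedFDeriv ℝ j (c k ∘ (ContinuousLinearMap.fst ℝ ℝ ℝ)) p‖ ≤ _
    rw [this]
    refine (ContinuousMultilinearMap.norm_compContinuousLinearMap_le _ _).trans ?_
    simp only [Finset.prod_const, Finset.card_univ, Fintype.card_fin]
    refine mul_le_of_le_one_right (norm_nonneg _) (pow_le_one₀ (norm_nonneg _) (ContinuousLinearMap.norm_fst_le _ _ _))
  let V : ℕ → ℝ := fun n => ∑ j ∈ Finset.range (n+1), (n.choose j : ℝ) * (D (N (n-j) + 2) j * C (n-j))
  have bF : ∀ n l k p, ‖iteratedFDeriv ℝ n (F l k) p‖ ≤ V n * ((((k.natAbs:ℝ)+1)^2)⁻¹) := by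
    intro n l k p
    refine (norm_iteratedFDeriv_mul_le (scf k) (sa _ l) p (n := n) (by exact_mod_cast le_top)).trans ?_
    simp only [V]
    rw [Finset.sum_mul]
    refine Finset.sum_le_sum fun j _ => ?_
    rw [mul_assoc, mul_assoc]
    refine mul_le_mul_of_nonneg_left ?_ (by positivity)
    have h1 := (bcf k j p)
    have h2 := hD (N (n-j) + 2) j k p.1
    have h3 := ba k.natAbs l (n-j) p
    have hk : 0 < ((k.natAbs:ℝ)+1) := by positivity
    set x := ((k.natAbs:ℝ)+1)
    rw [← le_div_iff₀ (by positivity)] at h2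
    calc _ ≤ (D (N (n-j) + 2) j / x^(N (n-j) + 2)) * (C (n-j) * x^(N (n-j))) := by
          have := D0 (N (n-j) + 2) j
          exact mul_le_mul (h1.trans h2) h3 (norm_nonneg _) (by positivity)
      _ = _ := by rw [pow_add]; field_simp
  have sumF : ∀ l p, Summable (fun k => F l k p) := by
    intro l p
    refine Summable.of_norm_bounded (g := fun k : ℤ => V 0 * ((((k.natAbs:ℝ)+1)^2)⁻¹)) (summable_int_inv.mul_left _) fun k => ?_
    have := bF 0 l k p
    rwa [norm_iteratedFDeriv_zero] at this
  have sS : ∀ l, ContDiff ℝ ∞ (fun p => ∑' k, F l k p) := by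
    intro l
    exact contDiff_tsum (N := (⊤ : ℕ∞)) (v := fun n (k:ℤ) => V n * ((((k.natAbs:ℝ)+1)^2)⁻¹)) (sF l)
      (fun n _ => summable_int_inv.mul_left _) (fun n k x _ => bF n l k x)
  refine ⟨fun l p => (∑' k, F l k p).re, fun l => Complex.reCLM.contDiff.comp (sS l), ?_⟩
  intro v X hv hX
  set q : ℝ × ℝ := (v, X^3+v*X^2) with hq
  have h0 := (sumF 0 q).hasSum
  have h1 := ((sumF 1 q).hasSum).mul_right (X:ℂ)
  have h2 := ((sumF 2 q).hasSum).mul_right ((X:ℂ)^2)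
  have h3 := (h0.add h1).add h2
  have e : (fun k => F 0 k q + F 1 k q * (X:ℂ) + F 2 k q * (X:ℂ)^2) =
      fun k : ℤ => c k v * (Polynomial.Chebyshev.T ℂ (k.natAbs:ℤ)).eval (X:ℂ) := by
    funext k
    have := ha k.natAbs v X hv hX
    simp only [F]
    rw [← this]
    simp only [hq]
    ring
  rw [e] at h3
  have h4 := (hc v X hv hX).unique h3
  have h5 := congrArg Complex.re h4
  simp only [Complex.ofReal_re, Complex.add_re, ← Complex.ofReal_pow, Complex.re_mul_ofReal] at h5
  exact h5

end Mond

open Filter Topology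
open scoped ContDiff
namespace Mond

theorem lin {E F : Type} [NormedAddCommGroup E] [NormedSpace ℝ E] [NormedAddCommGroup F] [NormedSpace ℝ F]
    (f : E → F) (hf : DifferentiableAt ℝ f 0) (w : E) (ψ : ℝ → F) (hψ : ContinuousAt ψ 0)
    (h : ∀ᶠ x in 𝓝 (0:ℝ), f (x • w) = x • ψ x) : fderiv ℝ f 0 w = ψ 0 := by
  have h0 : HasDerivAt (fun x : ℝ => x • w) w 0 := by simpa using (hasDerivAt_id (0:ℝ)).smul_const w
  have h1 : HasDerivAt (fun x : ℝ => f (x • w)) (fderiv ℝ f 0 w) 0 := by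
    have hf' : HasFDerivAt f (fderiv ℝ f 0) ((0:ℝ) • w) := by rw [zero_smul]; exact hf.hasFDerivAt
    exact hf'.comp_hasDerivAt 0 h0
  have h2 : HasDerivAt (fun x : ℝ => x • ψ x) (fderiv ℝ f 0 w) 0 := h1.congr_of_eventuallyEq (h.mono fun x hx => hx.symm)
  have h3 := h2.tendsto_slope
  have h4 : Tendsto ψ (𝓝[≠] 0) (𝓝 (ψ 0)) := hψ.tendsto.mono_left nhdsWithin_le_nhds
  refine tendsto_nhds_unique (h3.congr' ?_) h4
  filter_upwards [self_mem_nhdsWithin] with x hx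
  simp only [slope, vsub_eq_sub, zero_smul, sub_zero]
  rw [smul_smul, inv_mul_cancel₀ hx, one_smul]

/-- the tangent coordinate function built from `η = t ^ 3 * e` -/
noncomputable def hh (e : ℝ → ℝ) (u t : ℝ) : ℝ := t^3 * e t + (u - t) * (3 * t^2 * e t + t^3 * deriv e t)

theorem deriv_smooth {e : ℝ → ℝ} (he : ContDiff ℝ ∞ e) : ContDiff ℝ ∞ (deriv e) := by
  have h : (deriv e) = fun x => fderiv ℝ e x 1 := by funext x; simp
  rw [h]
  exact (he.fderiv_right (by simp)).clm_apply contDiff_const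

theorem inv_germ (Z : ℝ × ℝ → ℝ) (hZ : ContDiff ℝ ∞ Z) (h0 : Z 0 ≠ 0) :
    ∃ J : ℝ × ℝ → ℝ, ContDiff ℝ ∞ J ∧ ∀ᶠ p in 𝓝 0, J p = (Z p)⁻¹ := by
  have : ∀ᶠ p in 𝓝 (0 : ℝ × ℝ), ContDiffAt ℝ ∞ (fun p => (Z p)⁻¹) p := by
    filter_upwards [hZ.continuous.continuousAt.eventually_ne h0] with p hp
    exact hZ.contDiffAt.inv hp
  exact globalize _ _ this

/-- Implicit function theorem in the form needed. -/
theorem implicit (A : (ℝ × ℝ) × ℝ → ℝ) (hA : ContDiff ℝ ∞ A) (w0 a : ℝ) (ha : a ≠ 0)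
    (h : ∀ x, A (0, x) = a * (x - w0)) : ∃ W : ℝ × ℝ → ℝ, ContDiff ℝ ∞ W ∧ W 0 = w0 ∧ ∀ᶠ p in 𝓝 0, A (p, W p) = 0 := by
  let Φ : (ℝ × ℝ) × ℝ → (ℝ × ℝ) × ℝ := fun q => (q.1, A (q.1, w0 + q.2))
  have sA : ContDiff ℝ ∞ (fun q : (ℝ × ℝ) × ℝ => A (q.1, w0 + q.2)) := hA.comp (by fun_prop)
  have sΦ : ContDiff ℝ ∞ Φ := contDiff_fst.prodMk sA
  have Φ0 : Φ 0 = 0 := by simp [Φ, h]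
  obtain ⟨Ψ, sΨ, Ψ0, -, hΨ⟩ := smooth_inv Φ sΦ Φ0 (by
    intro w hw
    have dA := (sA.differentiable (by simp) 0).hasFDerivAt
    have dΦ : HasFDerivAt Φ ((ContinuousLinearMap.fst ℝ (ℝ × ℝ) ℝ).prod (fderiv ℝ (fun q : (ℝ × ℝ) × ℝ => A (q.1, w0 + q.2)) 0)) 0 :=
      hasFDerivAt_fst.prodMk dA
    rw [dΦ.fderiv] at hw
    obtain ⟨w1, w2⟩ := w
    simp only [ContinuousLinearMap.prod_apply, ContinuousLinearMap.coe_fst', Prod.mk_eq_zero] at hw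
    obtain ⟨h1, h2⟩ := hw
    subst h1
    rw [lin _ (sA.differentiable (by simp) 0) (0, w2) (fun _ => a * w2) continuousAt_const
      (Eventually.of_forall fun x => by simp [h]; ring)] at h2
    simpa [ha] using h2)
  refine ⟨fun p => w0 + (Ψ (p, 0)).2, contDiff_const.add (contDiff_snd.comp (sΨ.comp (by fun_prop))), ?_, ?_⟩
  · have : ((0 : ℝ × ℝ), (0:ℝ)) = 0 := rfl
    simp [this, Ψ0]
  · have ht : Tendsto (fun p : ℝ × ℝ => (p, (0:ℝ))) (𝓝 0) (𝓝 0) := by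
      have : Continuous (fun p : ℝ × ℝ => (p, (0:ℝ))) := by fun_prop
      exact this.tendsto 0
    filter_upwards [ht.eventually hΨ] with p hp
    simp only [Φ, Prod.mk.injEq] at hp
    rw [hp.1] at hp
    exact hp.2

theorem core (e1 : ℝ → ℝ) (he1 : ContDiff ℝ ∞ e1) (h10 : e1 0 ≠ 0) :
    ∃ X : ℝ × ℝ → ℝ, ContDiff ℝ ∞ X ∧ X 0 = 0 ∧ (∀ w, fderiv ℝ X 0 w = w.2) ∧
    (∀ᶠ p : ℝ × ℝ in 𝓝 0, hh e1 p.1 p.2 = -2 * e1 p.1 * (X p ^ 3 - 3/2 * p.1 * X p ^ 2)) ∧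
    ∀ e : ℝ → ℝ, ContDiff ℝ ∞ e → ∃ a : Fin 3 → ℝ × ℝ → ℝ, (∀ l, ContDiff ℝ ∞ (a l)) ∧
      (∀ᶠ p : ℝ × ℝ in 𝓝 0, hh e p.1 p.2 = -2 * e p.1 * (X p ^ 3 - 3/2 * p.1 * X p ^ 2) +
        (3 * X p * (X p - p.1))^2 * (a 0 (-3/2 * p.1, X p ^ 3 + -3/2 * p.1 * X p ^ 2) +
          a 1 (-3/2 * p.1, X p ^ 3 + -3/2 * p.1 * X p ^ 2) * X p +
          a 2 (-3/2 * p.1, X p ^ 3 + -3/2 * p.1 * X p ^ 2) * X p ^ 2)) ∧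
      (e 0 = 0 → a 0 0 = - deriv e 0 / 3) ∧
      (e 0 = 0 → deriv e 0 = 0 → a 1 0 = -2 * iteratedDeriv 2 e 0 / 9) := by
  -- abbreviations
  have sd := deriv_smooth he1
  obtain ⟨R1, sR1, hR1, -⟩ := taylor2 e1 he1
  let P : (ℝ × ℝ) × ℝ → ℝ := fun q => 3 * q.2 + (3 * q.1.2 - 3/2 * q.1.1) * q.2^2 + q.1.2 * (q.1.2 - q.1.1) * q.2^3
  have sP : ContDiff ℝ ∞ P := by fun_prop
  let B1 : ℝ × ℝ → ℝ := fun p => 3 * deriv e1 p.2 + (3 * p.1 - 2 * p.2) * R1 p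
  have sB1 : ContDiff ℝ ∞ B1 := by fun_prop
  obtain ⟨W, sW, hW0, hW⟩ := implicit (fun q => 2 * e1 q.1.1 * P q - B1 q.1) (by fun_prop)
    (B1 0 / (6 * e1 0)) (6 * e1 0) (by simpa using h10) (by
      intro x
      simp only [P, B1, Prod.fst_zero, Prod.snd_zero]
      field_simp
      ring)
  let X : ℝ × ℝ → ℝ := fun p => p.2 + p.2 * (p.2 - p.1) * W p
  have sX : ContDiff ℝ ∞ X := by fun_prop
  have X0 : X 0 = 0 := by simp [X]
  have dX : ∀ w, fderiv ℝ X 0 w = w.2 := by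
    intro w
    rw [lin X (sX.differentiable (by simp) 0) w (fun x => w.2 + x * (w.2 * (w.2 - w.1) * W (x • w)))
      (by
        have : Continuous (fun x : ℝ => w.2 + x * (w.2 * (w.2 - w.1) * W (x • w))) := by
          have := sW.continuous; fun_prop
        exact this.continuousAt) (Eventually.of_forall fun x => by simp [X]; ring)]
    simp
  let Z : ℝ × ℝ → ℝ := fun p => 9 * ((1 + (p.2 - p.1) * W p) * (1 + p.2 * W p))^2
  have sZ : ContDiff ℝ ∞ Z := by fun_prop
  have Z0 : Z 0 = 9 := by simp [Z]
  obtain ⟨J, sJ, hJ⟩ := inv_germ Z sZ (by rw [Z0]; norm_num)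
  have hZne : ∀ᶠ p in 𝓝 (0 : ℝ × ℝ), Z p ≠ 0 := sZ.continuous.continuousAt.eventually_ne (by rw [Z0]; norm_num)
  have J0 : J 0 = 1/9 := by rw [hJ.self_of_nhds, Z0]; norm_num
  -- the change of coordinates
  let Θ : ℝ × ℝ → ℝ × ℝ := fun p => (-3/2 * p.1, X p)
  have sΘ : ContDiff ℝ ∞ Θ := (contDiff_const.mul contDiff_fst).prodMk sX
  have Θ0 : Θ 0 = 0 := by simp [Θ, X0]
  obtain ⟨Ξ, sΞ, Ξ0, hΞ, -⟩ := smooth_inv Θ sΘ Θ0 (by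
    intro w hw
    have d1 : HasFDerivAt (fun p : ℝ × ℝ => -3/2 * p.1) ((-3/2 : ℝ) • ContinuousLinearMap.fst ℝ ℝ ℝ) 0 :=
      hasFDerivAt_fst.const_mul (-3/2 : ℝ)
    have dΘ : HasFDerivAt Θ _ 0 := d1.prodMk (sX.differentiable (by simp) 0).hasFDerivAt
    rw [dΘ.fderiv] at hw
    obtain ⟨w1, w2⟩ := w
    simpa [dX] using hw)
  have small : ∀ᶠ p in 𝓝 (0 : ℝ × ℝ), |-3/2 * p.1| ≤ 1/20 ∧ |X p| ≤ 1/20 := by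
    have c1 : Continuous (fun p : ℝ × ℝ => |-3/2 * p.1|) := by fun_prop
    have c2 : Continuous (fun p : ℝ × ℝ => |X p|) := sX.continuous.abs
    have l1 : ∀ᶠ p in 𝓝 (0 : ℝ × ℝ), |-3/2 * p.1| < 1/20 := c1.continuousAt.eventually_lt_const (by simp)
    have l2 : ∀ᶠ p in 𝓝 (0 : ℝ × ℝ), |X p| < 1/20 := c2.continuousAt.eventually_lt_const (by simp [X0])
    filter_upwards [l1, l2] with p h1 h2 using ⟨h1.le, h2.le⟩
  refine ⟨X, sX, X0, dX, ?_, ?_⟩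
  · filter_upwards [hW] with p hp
    have hR := hR1 p.1 p.2
    simp only [P, B1] at hp
    simp only [hh, X]
    rw [hR] at hp ⊢
    linear_combination (p.2^2 * (p.2-p.1)^2) * hp
  intro e he
  have se := deriv_smooth he
  obtain ⟨R, sR, hR, hR0⟩ := taylor2 e he
  let B : ℝ × ℝ → ℝ := fun p => 3 * deriv e p.2 + (3 * p.1 - 2 * p.2) * R p
  have sB : ContDiff ℝ ∞ B := by fun_prop
  let g : ℝ × ℝ → ℝ := fun p => (2 * e p.1 * P (p, W p) - B p) * J p
  have sg : ContDiff ℝ ∞ g := by fun_prop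
  obtain ⟨a, sa, ha⟩ := malgrange (g ∘ Ξ) (sg.comp sΞ)
  have hga : ∀ᶠ p in 𝓝 (0 : ℝ × ℝ), g p = a 0 (-3/2 * p.1, X p ^ 3 + -3/2 * p.1 * X p ^ 2) +
          a 1 (-3/2 * p.1, X p ^ 3 + -3/2 * p.1 * X p ^ 2) * X p +
          a 2 (-3/2 * p.1, X p ^ 3 + -3/2 * p.1 * X p ^ 2) * X p ^ 2 := by
    filter_upwards [small, hΞ] with p hp1 hp2
    rw [← ha _ _ hp1.1 hp1.2]
    change g p = g (Ξ (Θ p))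
    rw [hp2]
  refine ⟨a, sa, ?_, ?_, ?_⟩
  · filter_upwards [hga, hJ, hZne] with p h1 h2 h3
    rw [← h1]
    simp only [g, h2]
    have e2 : (3 * X p * (X p - p.1))^2 = (p.2 * (p.2 - p.1))^2 * Z p := by simp only [X, Z]; ring
    rw [e2]
    have e3 : (p.2 * (p.2 - p.1))^2 * Z p * ((2 * e p.1 * P (p, W p) - B p) * (Z p)⁻¹) =
        (p.2 * (p.2 - p.1))^2 * (2 * e p.1 * P (p, W p) - B p) := by field_simp
    rw [e3]
    simp only [hh, B, X, P]
    rw [hR p.1 p.2]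
    ring
  · intro h0
    have := hga.self_of_nhds
    simp [X0, g, h0, B, J0] at this
    rw [show ((0:ℝ),(0:ℝ)) = 0 from rfl] at this
    rw [← this]
    ring
  · intro h0 h1
    have ht : Tendsto (fun t : ℝ => ((0:ℝ), t)) (𝓝 0) (𝓝 0) := by
      have : Continuous (fun t : ℝ => ((0:ℝ), t)) := by fun_prop
      exact this.tendsto 0
    have hga' := ht.eventually hga
    have a00 : a 0 0 = 0 := by
      have := hga.self_of_nhds
      simp [X0, g, h0, h1, B] at this
      rw [show ((0:ℝ),(0:ℝ)) = 0 from rfl] at this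
      exact this.symm
    have dg : HasDerivAt (fun t : ℝ => g (0, t)) (-2 * iteratedDeriv 2 e 0 / 9) 0 := by
      have d1 : HasDerivAt (fun t : ℝ => deriv e t) (iteratedDeriv 2 e 0) 0 := by
        have := (se.differentiable (by simp) 0).hasDerivAt
        rwa [iteratedDeriv_succ, iteratedDeriv_one]
      have dR : DifferentiableAt ℝ (fun t : ℝ => R (0, t)) 0 := by
        have : ContDiff ℝ ∞ (fun t : ℝ => R (0, t)) := by fun_prop
        exact this.differentiable (by simp) 0
      have dJ : DifferentiableAt ℝ (fun t : ℝ => J (0, t)) 0 := by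
        have : ContDiff ℝ ∞ (fun t : ℝ => J (0, t)) := by fun_prop
        exact this.differentiable (by simp) 0
      have d2 := ((d1.const_mul 3).add (((hasDerivAt_id (0:ℝ)).const_mul (-2)).mul dR.hasDerivAt)).neg.mul dJ.hasDerivAt
      have e1 : (fun t : ℝ => g (0, t)) = fun t => -(3 * deriv e t + (-2 * t) * R (0, t)) * J (0, t) := by
        funext t; simp [g, B, h0]
      rw [e1]
      convert! d2 using 1
      have j0 : J (0, 0) = 1/9 := J0
      have r0 : R (0, 0) = iteratedDeriv 2 e 0 / 2 := hR0
      simp [h1, j0, r0]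
      ring
    have dXt : HasDerivAt (fun t : ℝ => X (0, t)) 1 0 := by
      have h0 : HasDerivAt (fun t : ℝ => ((0:ℝ), t)) ((0:ℝ), (1:ℝ)) 0 := (hasDerivAt_const _ _).prodMk (hasDerivAt_id _)
      have := HasFDerivAt.comp_hasDerivAt (0:ℝ) (l := X) (sX.differentiable (by simp) ((0:ℝ),(0:ℝ))).hasFDerivAt h0
      have e : fderiv ℝ X ((0:ℝ),(0:ℝ)) ((0:ℝ),(1:ℝ)) = 1 := dX (0, 1)
      rw [e] at this
      exact this
    have Xt0 : X (0, 0) = 0 := X0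
    have dal : ∀ l, ∃ d, HasDerivAt (fun t : ℝ => a l (0, X (0, t)^3)) d 0 ∧ (l = 0 → d = 0) := by
      intro l
      have s1 : ContDiff ℝ ∞ (fun y : ℝ => a l (0, y)) := by have := sa l; fun_prop
      have h1 := (s1.differentiable (by simp) ((X (0,0))^3)).hasDerivAt
      have h2 := dXt.pow 3
      have h3 := HasDerivAt.comp (0:ℝ) h1 h2
      refine ⟨_, h3, fun _ => ?_⟩
      simp [Xt0]
    obtain ⟨d0, hd0, z0⟩ := dal 0
    obtain ⟨d1, hd1, -⟩ := dal 1
    obtain ⟨d2, hd2, -⟩ := dal 2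
    have dr := (hd0.add (hd1.mul dXt)).add (hd2.mul (dXt.pow 2))
    have dg2 := dg.congr_of_eventuallyEq (f₁ := _) (hga'.mono fun t ht => ht.symm)
    simp only [mul_zero, zero_mul, add_zero] at dg2
    have := dg2.unique dr
    simp only [Xt0, z0 rfl] at this
    norm_num at this
    rw [show ((0:ℝ),(0:ℝ)) = 0 from rfl, X0] at this
    linarith

end Mond

open Filter Topology
open scoped ContDiff
namespace Mond

theorem compE (ρ φ : ℝ → ℝ) (sρ : ContDiff ℝ ∞ ρ) (sφ : ContDiff ℝ ∞ φ) (hφ : ∀ t, φ t = t * ρ t)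
    (δ : ℝ → ℝ) (sδ : ContDiff ℝ ∞ δ) (h0 : δ 0 = 0) (h1 : iteratedDeriv 1 δ 0 = 0) (h2 : iteratedDeriv 2 δ 0 = 0) :
    ∃ e : ℝ → ℝ, ContDiff ℝ ∞ e ∧ (∀ t, δ (φ t) = t^3 * e t) ∧
      (e 0 = ρ 0 ^ 3 * (iteratedDeriv 3 δ 0 / 6)) ∧
      (iteratedDeriv 3 δ 0 = 0 → deriv e 0 = ρ 0 ^ 4 * (iteratedDeriv 4 δ 0 / 24)) ∧
      (iteratedDeriv 3 δ 0 = 0 → iteratedDeriv 4 δ 0 = 0 → iteratedDeriv 2 e 0 = ρ 0 ^ 5 * (iteratedDeriv 5 δ 0 / 60)) := by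
  obtain ⟨x1, s1, k1, D1⟩ := div_id δ sδ h0
  have z1 : x1 0 = 0 := by have := D1 0; rw [h1] at this; simpa using this.symm
  obtain ⟨x2, s2, k2, D2⟩ := div_id x1 s1 z1
  have z2 : x2 0 = 0 := by
    have := D1 1; rw [h2, D2 0] at this; simpa using this.symm
  obtain ⟨d, s3, k3, D3⟩ := div_id x2 s2 z2
  have φ0 : φ 0 = 0 := by simp [hφ]
  have f3 : iteratedDeriv 3 δ 0 = 6 * d 0 := by
    rw [D1 2, D2 1, D3 0]; simp; ring
  have f4 : iteratedDeriv 4 δ 0 = 24 * iteratedDeriv 1 d 0 := by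
    rw [D1 3, D2 2, D3 1]; push_cast; ring
  have f5 : iteratedDeriv 5 δ 0 = 60 * iteratedDeriv 2 d 0 := by
    rw [D1 4, D2 3, D3 2]; push_cast; ring
  let e : ℝ → ℝ := fun t => ρ t ^ 3 * d (φ t)
  have se : ContDiff ℝ ∞ e := by fun_prop
  have e0 : e 0 = ρ 0 ^ 3 * d 0 := by simp [e, φ0]
  refine ⟨e, se, ?_, ?_, ?_, ?_⟩
  · intro t
    rw [k1, k2, k3, hφ]
    simp only [e, hφ]; ring
  · rw [e0, f3]; ring
  · intro h
    obtain ⟨b, s4, k4, D4⟩ := div_id d s3 (by linarith)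
    have ee : e = fun t => t * (ρ t ^ 4 * b (φ t)) := by
      funext t; simp only [e]; rw [k4, hφ]; ring
    have := congrFun (iteratedDeriv_id_mul (fun t => ρ t ^ 4 * b (φ t)) (by fun_prop) 0) 0
    rw [← iteratedDeriv_one, ee]
    rw [zero_add] at this
    rw [this, f4, D4 0]
    simp [φ0]
  · intro h h'
    obtain ⟨b, s4, k4, D4⟩ := div_id d s3 (by linarith)
    obtain ⟨c, s5, k5, D5⟩ := div_id b s4 (by
      have := D4 0; rw [iteratedDeriv_zero] at this; norm_num at this; rw [← this, ← iteratedDeriv_one]; linarith)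
    have ee : e = fun t => t * (t * (ρ t ^ 5 * c (φ t))) := by
      funext t; simp only [e]; rw [k4, k5, hφ]; ring
    have g1 := congrFun (iteratedDeriv_id_mul (fun t => t * (ρ t ^ 5 * c (φ t))) (by fun_prop) 1) 0
    have g2 := congrFun (iteratedDeriv_id_mul (fun t => ρ t ^ 5 * c (φ t)) (by fun_prop) 0) 0
    rw [zero_add] at g2
    rw [ee]
    norm_num at g1 g2
    rw [g1, g2, f5, D4 1, D5 0]
    simp [φ0]; ring

theorem phi_exists (δ : ℝ → ℝ) (sδ : ContDiff ℝ ∞ δ) (h0 : δ 0 = 0) (h1 : deriv δ 0 = 1) :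
    ∃ ρ φ : ℝ → ℝ, ContDiff ℝ ∞ ρ ∧ ContDiff ℝ ∞ φ ∧ (∀ t, φ t = t * ρ t) ∧ ρ 0 = 1 ∧ ∀ᶠ t in 𝓝 0, φ (δ t) = t := by
  obtain ⟨φ, sφ, φ0, hφ, -⟩ := smooth_inv δ sδ h0 (by
    intro w hw
    have : fderiv ℝ δ 0 w = w := by
      rw [fderiv_eq_smul_deriv, h1]; simp
    rwa [this] at hw)
  obtain ⟨ρ, sρ, k, D⟩ := div_id φ sφ φ0
  refine ⟨ρ, φ, sρ, sφ, k, ?_, hφ⟩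
  have d1 : HasDerivAt φ (deriv φ 0) (δ 0) := by rw [h0]; exact (sφ.differentiable (by simp) 0).hasDerivAt
  have d2 : HasDerivAt δ (deriv δ 0) 0 := (sδ.differentiable (by simp) 0).hasDerivAt
  have d3 := d1.comp (0:ℝ) d2
  have d4 := (hasDerivAt_id (0:ℝ)).congr_of_eventuallyEq (f₁ := φ ∘ δ) hφ
  have := d3.unique d4
  have D0 := D 0
  rw [zero_add, iteratedDeriv_one] at D0
  rw [h1, D0] at this
  simpa using this

theorem exists_equiv {m : ℕ} (v w : Fin 4 → Fin m → ℝ) (hv : LinearIndependent ℝ v) (hw : LinearIndependent ℝ w) :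
    ∃ L : (Fin m → ℝ) ≃L[ℝ] (Fin m → ℝ), ∀ j, L (v j) = w j := by
  let b := Module.Basis.sumExtend hv
  let c := Module.Basis.sumExtend hw
  have hb : ∀ j, b (Sum.inl j) = v j := by intro j; simp [b, Module.Basis.sumExtend]; rfl
  have hc : ∀ j, c (Sum.inl j) = w j := by intro j; simp [c, Module.Basis.sumExtend]; rfl
  have : Fintype (Fin 4 ⊕ Module.Basis.sumExtendIndex hv) := FiniteDimensional.fintypeBasisIndex b
  have : Fintype (Fin 4 ⊕ Module.Basis.sumExtendIndex hw) := FiniteDimensional.fintypeBasisIndex c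
  have f1 : Finite (Module.Basis.sumExtendIndex hv) := Finite.sum_right (Fin 4)
  have f2 : Finite (Module.Basis.sumExtendIndex hw) := Finite.sum_right (Fin 4)
  have e1 := Module.finrank_eq_nat_card_basis b
  have e2 := Module.finrank_eq_nat_card_basis c
  rw [Nat.card_sum] at e1 e2
  have e3 : Nat.card (Module.Basis.sumExtendIndex hv) = Nat.card (Module.Basis.sumExtendIndex hw) := by omega
  let ε : Module.Basis.sumExtendIndex hv ≃ Module.Basis.sumExtendIndex hw := Classical.choice (by
    have := Fintype.ofFinite (Module.Basis.sumExtendIndex hv)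
    have := Fintype.ofFinite (Module.Basis.sumExtendIndex hw)
    rw [Nat.card_eq_fintype_card, Nat.card_eq_fintype_card] at e3
    exact Fintype.card_eq.1 e3)
  refine ⟨(b.equiv c (Equiv.sumCongr (Equiv.refl _) ε)).toContinuousLinearEquiv, fun j => ?_⟩
  rw [LinearEquiv.coe_toContinuousLinearEquiv', ← hb, Module.Basis.equiv_apply, ← hc]
  rfl

theorem iteratedDeriv_clm {m : ℕ} (ℓ : (Fin m → ℝ) →L[ℝ] ℝ) (γ : ℝ → Fin m → ℝ) (sγ : ContDiff ℝ ∞ γ) (c : ℝ) (k : ℕ) :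
    iteratedDeriv (k+1) (fun t => ℓ (γ t) - c) = fun t => ℓ (iteratedDeriv (k+1) γ t) := by
  have hdiff : ∀ k t, HasDerivAt (iteratedDeriv k γ) (iteratedDeriv (k + 1) γ t) t := by
    intro k t
    rw [iteratedDeriv_succ]
    exact (sγ.differentiable_iteratedDeriv k (by exact_mod_cast WithTop.coe_lt_top k) t).hasDerivAt
  induction k with
  | zero =>
    funext t
    rw [zero_add, iteratedDeriv_one]
    have := (ℓ.hasFDerivAt.comp_hasDerivAt t (hdiff 0 t)).sub_const c
    exact this.deriv
  | succ k ih =>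
    funext t
    rw [iteratedDeriv_succ, ih]
    exact (ℓ.hasFDerivAt.comp_hasDerivAt t (hdiff (k+1) t)).deriv

theorem indep {V : Type} [AddCommGroup V] [Module ℝ V] (v1 v2 v3 v4 v5 : V)
    (h2 : v2 ∈ Submodule.span ℝ ({v1} : Set V))
    (h5 : Module.finrank ℝ ↥(Submodule.span ℝ ({v1, v2, v3, v4, v5} : Set V)) = 4) :
    LinearIndependent ℝ ![v1, v3, v4, v5] := by
  rw [linearIndependent_iff_card_eq_finrank_span, Set.finrank]
  have e : Submodule.span ℝ (Set.range ![v1, v3, v4, v5]) = Submodule.span ℝ ({v1, v2, v3, v4, v5} : Set V) := by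
    have r : Set.range ![v1, v3, v4, v5] = {v1, v3, v4, v5} := by
      simp [Matrix.range_cons, Matrix.range_empty]
      ext x; simp; tauto
    rw [r]
    apply le_antisymm
    · apply Submodule.span_mono
      intro x; simp; tauto
    · rw [Submodule.span_le]
      have h2' : v2 ∈ Submodule.span ℝ ({v1, v3, v4, v5} : Set V) := Submodule.span_mono (by simp) h2
      intro x hx
      simp only [Set.mem_insert_iff, Set.mem_singleton_iff] at hx
      rcases hx with rfl | rfl | hx
      · exact Submodule.subset_span (by simp)
      · exact h2'
      · exact Submodule.subset_span (by simp; tauto)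
  rw [e, h5]; simp

end Mond

open Filter Topology
open scoped ContDiff
namespace Mond

/-- the open Mond surface -/
noncomputable def mond (m : ℕ) (p : ℝ × ℝ) : Fin m → ℝ := fun i : Fin m =>
        if (i : ℕ) = 0 then p.1
        else if (i : ℕ) = 1 then p.2 ^ 3 + p.1 * p.2 ^ 2
        else if (i : ℕ) = 2 then (3/4) * p.2 ^ 4 + (2/3) * p.1 * p.2 ^ 3
        else if (i : ℕ) = 3 then (3/5) * p.2 ^ 5 + (1/2) * p.1 * p.2 ^ 4
        else 0

/-- the target coordinate change, `i`-th component, for `i ≥ 2` -/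
noncomputable def alpha (e : ℝ → ℝ) (a : Fin 3 → ℝ × ℝ → ℝ) (y0 y1 y2 y3 : ℝ) : ℝ :=
  -2 * e (-2/3 * y0) * y1 + a 0 (y0, y1) * (12 * y2 + 4 * y0 * y1) + a 1 (y0, y1) * (15 * y3 + 6 * y0 * y2) +
    a 2 (y0, y1) * (9 * y1^2 - 10 * y0 * y3)

theorem alpha_mond (e : ℝ → ℝ) (a : Fin 3 → ℝ × ℝ → ℝ) (u X : ℝ) :
    alpha e a (-3/2 * u) (X ^ 3 + -3/2 * u * X ^ 2) ((3/4) * X ^ 4 + (2/3) * (-3/2 * u) * X ^ 3)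
      ((3/5) * X ^ 5 + (1/2) * (-3/2 * u) * X ^ 4) =
      -2 * e u * (X ^ 3 - 3/2 * u * X ^ 2) +
        (3 * X * (X - u))^2 * (a 0 (-3/2 * u, X ^ 3 + -3/2 * u * X ^ 2) +
          a 1 (-3/2 * u, X ^ 3 + -3/2 * u * X ^ 2) * X +
          a 2 (-3/2 * u, X ^ 3 + -3/2 * u * X ^ 2) * X ^ 2) := by
  unfold alpha
  rw [show -2/3 * (-3/2 * u) = u by ring]
  ring

/-- The target diffeomorphism. -/
theorem target (m : ℕ) (hm : 4 ≤ m) (e : Fin m → ℝ → ℝ) (se : ∀ i, ContDiff ℝ ∞ (e i))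
    (a : Fin m → Fin 3 → ℝ × ℝ → ℝ) (sa : ∀ i l, ContDiff ℝ ∞ (a i l))
    (h1 : e ⟨1, by omega⟩ 0 ≠ 0) (h2 : a ⟨2, by omega⟩ 0 0 ≠ 0) (h3 : a ⟨3, by omega⟩ 0 0 = 0)
    (h3' : a ⟨3, by omega⟩ 1 0 ≠ 0) :
    ∃ T Tinv : (Fin m → ℝ) → (Fin m → ℝ), ContDiff ℝ ∞ T ∧ ContDiff ℝ ∞ Tinv ∧ T 0 = 0 ∧ Tinv 0 = 0 ∧
      (∀ᶠ x in 𝓝 0, Tinv (T x) = x) ∧ (∀ᶠ x in 𝓝 0, T (Tinv x) = x) ∧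
      ∀ y i, T y i = if (i:ℕ) = 0 then -2/3 * y ⟨0, by omega⟩
        else if (i:ℕ) = 1 then -2 * e i (-2/3 * y ⟨0, by omega⟩) * y ⟨1, by omega⟩
        else (if (i:ℕ) < 4 then 0 else y i) +
          alpha (e i) (a i) (y ⟨0, by omega⟩) (y ⟨1, by omega⟩) (y ⟨2, by omega⟩) (y ⟨3, by omega⟩) := by
  set i0 : Fin m := ⟨0, by omega⟩ with hi0
  set i1 : Fin m := ⟨1, by omega⟩ with hi1
  set i2 : Fin m := ⟨2, by omega⟩ with hi2
  set i3 : Fin m := ⟨3, by omega⟩ with hi3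
  let T : (Fin m → ℝ) → (Fin m → ℝ) := fun y i => if (i:ℕ) = 0 then -2/3 * y i0
        else if (i:ℕ) = 1 then -2 * e i (-2/3 * y i0) * y i1
        else (if (i:ℕ) < 4 then 0 else y i) + alpha (e i) (a i) (y i0) (y i1) (y i2) (y i3)
  have sT : ContDiff ℝ ∞ T := by
    refine contDiff_pi.2 fun i => ?_
    simp only [T]
    have := se i
    have := sa i 0
    have := sa i 1
    have := sa i 2
    split_ifs
    · fun_prop
    · fun_prop
    · unfold alpha; fun_prop
    · unfold alpha; fun_prop
  have T0 : T 0 = 0 := by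
    funext i
    simp [T, alpha]
  obtain ⟨Tinv, s, z, k1, k2⟩ := smooth_inv T sT T0 (by
    intro w hw
    let ψ : ℝ → Fin m → ℝ := fun x i => if (i:ℕ) = 0 then -2/3 * w i0
        else if (i:ℕ) = 1 then -2 * e i (-2/3 * (x * w i0)) * w i1
        else (if (i:ℕ) < 4 then 0 else w i) + 
          (-2 * e i (-2/3 * (x * w i0)) * w i1 + a i 0 (x * w i0, x * w i1) * (12 * w i2 + 4 * x * w i0 * w i1) + 
          a i 1 (x * w i0, x * w i1) * (15 * w i3 + 6 * x * w i0 * w i2) +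
          a i 2 (x * w i0, x * w i1) * (9 * x * w i1^2 - 10 * x * w i0 * w i3))
    have cψ : Continuous ψ := by
      refine continuous_pi fun i => ?_
      simp only [ψ]
      have := (se i).continuous
      have := (sa i 0).continuous
      have := (sa i 1).continuous
      have := (sa i 2).continuous
      split_ifs <;> fun_prop
    rw [lin T (sT.differentiable (by simp) 0) w ψ cψ.continuousAt (Eventually.of_forall fun x => by
      funext i
      simp only [T, ψ, Pi.smul_apply, smul_eq_mul, alpha]
      split_ifs <;> ring)] at hw
    have q : ∀ i, ψ 0 i = 0 := fun i => congrFun hw i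
    have w0 : w i0 = 0 := by have := q i0; simpa [ψ, hi0] using this
    have w1 : w i1 = 0 := by
      have := q i1
      have t : e i1 0 = 0 ∨ w i1 = 0 := by simpa [ψ, hi1] using this
      exact t.resolve_left h1
    have z00 : ((0:ℝ),(0:ℝ)) = 0 := rfl
    have w3 : w i3 = 0 := by
      have := q i3
      simp only [ψ, w0, w1, zero_mul, mul_zero, z00, h3] at this
      have t : a i3 1 0 = 0 ∨ w i3 = 0 := by simpa [hi3] using this
      exact t.resolve_left h3'
    have w2 : w i2 = 0 := by
      have := q i2
      simp only [ψ, w0, w1, w3, zero_mul, mul_zero, z00] at this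
      have t : a i2 0 0 = 0 ∨ w i2 = 0 := by simpa [hi2] using this
      exact t.resolve_left h2
    funext i
    have := q i
    simp only [ψ, w0, w1, w2, w3, zero_mul, mul_zero, z00] at this
    by_cases hi : (i:ℕ) < 4
    · have : i = i0 ∨ i = i1 ∨ i = i2 ∨ i = i3 := by
        simp only [Fin.ext_iff, hi0, hi1, hi2, hi3]; omega
      rcases this with rfl | rfl | rfl | rfl <;> simpa
    · have n0 : (i:ℕ) ≠ 0 := by omega
      have n1 : (i:ℕ) ≠ 1 := by omega
      simpa [hi, n0, n1] using this)
  exact ⟨T, Tinv, sT, s, T0, z, k1, k2, fun y i => rfl⟩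

theorem normal_form (m : ℕ) (hm : 4 ≤ m) (δ : Fin m → ℝ → ℝ) (sδ : ∀ i, ContDiff ℝ ∞ (δ i)) (h0 : ∀ i, δ i 0 = 0)
    (h1 : ∀ i : Fin m, iteratedDeriv 1 (δ i) 0 = if (i:ℕ) = 0 then 1 else 0)
    (h2 : ∀ i : Fin m, (i:ℕ) ≠ 0 → iteratedDeriv 2 (δ i) 0 = 0)
    (h3 : ∀ i : Fin m, iteratedDeriv 3 (δ i) 0 = if (i:ℕ) = 1 then 1 else 0)
    (h4 : ∀ i : Fin m, iteratedDeriv 4 (δ i) 0 = if (i:ℕ) = 2 then 1 else 0)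
    (h5 : ∀ i : Fin m, iteratedDeriv 5 (δ i) 0 = if (i:ℕ) = 3 then 1 else 0) :
    ∃ T Tinv : (Fin m → ℝ) → (Fin m → ℝ), ∃ Ψ Ψinv : ℝ × ℝ → ℝ × ℝ,
      ContDiff ℝ ∞ T ∧ ContDiff ℝ ∞ Tinv ∧ T 0 = 0 ∧ Tinv 0 = 0 ∧
      (∀ᶠ x in 𝓝 0, Tinv (T x) = x) ∧ (∀ᶠ x in 𝓝 0, T (Tinv x) = x) ∧
      ContDiff ℝ ∞ Ψ ∧ ContDiff ℝ ∞ Ψinv ∧ Ψ 0 = 0 ∧ 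
      (∀ᶠ x in 𝓝 0, Ψinv (Ψ x) = x) ∧ (∀ᶠ x in 𝓝 0, Ψ (Ψinv x) = x) ∧
      ∀ᶠ p : ℝ × ℝ in 𝓝 0, ∀ i, δ i p.2 + p.1 * deriv (δ i) p.2 = T (mond m (Ψ p)) i := by
  set i0 : Fin m := ⟨0, by omega⟩ with hi0
  set i1 : Fin m := ⟨1, by omega⟩ with hi1
  set i2 : Fin m := ⟨2, by omega⟩ with hi2
  set i3 : Fin m := ⟨3, by omega⟩ with hi3
  have d0 : deriv (δ i0) 0 = 1 := by have := h1 i0; rw [iteratedDeriv_one] at this; simpa [hi0] using this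
  obtain ⟨ρ, φ, sρ, sφ, hφ, ρ0, hφδ⟩ := phi_exists (δ i0) (sδ i0) (h0 i0) d0
  have he : ∀ i : Fin m, ∃ e : ℝ → ℝ, ContDiff ℝ ∞ e ∧ ((i:ℕ) ≠ 0 → (∀ t, δ i (φ t) = t^3 * e t) ∧
      (e 0 = ρ 0 ^ 3 * (iteratedDeriv 3 (δ i) 0 / 6)) ∧
      (iteratedDeriv 3 (δ i) 0 = 0 → deriv e 0 = ρ 0 ^ 4 * (iteratedDeriv 4 (δ i) 0 / 24)) ∧
      (iteratedDeriv 3 (δ i) 0 = 0 → iteratedDeriv 4 (δ i) 0 = 0 → iteratedDeriv 2 e 0 = ρ 0 ^ 5 * (iteratedDeriv 5 (δ i) 0 / 60))) := by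
    intro i
    by_cases hi : (i:ℕ) = 0
    · exact ⟨fun _ => 0, contDiff_const, fun h => absurd hi h⟩
    · obtain ⟨e, se, r⟩ := compE ρ φ sρ sφ hφ (δ i) (sδ i) (h0 i) (by rw [h1, if_neg hi]) (h2 i hi)
      exact ⟨e, se, fun _ => r⟩
  choose e se re using he
  have e10 : e i1 0 ≠ 0 := by
    rw [(re i1 (by simp [hi1])).2.1, h3, ρ0]; simp [hi1]
  have e20 : e i2 0 = 0 := by rw [(re i2 (by simp [hi2])).2.1, h3]; simp [hi2]
  have e30 : e i3 0 = 0 := by rw [(re i3 (by simp [hi3])).2.1, h3]; simp [hi3]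
  have e21 : deriv (e i2) 0 ≠ 0 := by
    rw [(re i2 (by simp [hi2])).2.2.1 (by rw [h3]; simp [hi2]), h4, ρ0]; simp [hi2]
  have e31 : deriv (e i3) 0 = 0 := by
    rw [(re i3 (by simp [hi3])).2.2.1 (by rw [h3]; simp [hi3]), h4, ρ0]; simp [hi3]
  have e32 : iteratedDeriv 2 (e i3) 0 ≠ 0 := by
    rw [(re i3 (by simp [hi3])).2.2.2 (by rw [h3]; simp [hi3]) (by rw [h4]; simp [hi3]), h5, ρ0]; simp [hi3]
  obtain ⟨X, sX, X0, dX, hX1, hX⟩ := core (e i1) (se i1) e10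
  choose a sa ha ha0 ha1 using fun i => hX (e i) (se i)
  obtain ⟨T, Tinv, sT, sTi, T0, Ti0, k1, k2, hT⟩ := target m hm e se a sa e10
    (by rw [ha0 i2 e20]; simpa using e21) (by rw [ha0 i3 e30, e31]; simp)
    (by rw [ha1 i3 e30 e31]; simpa using e32)
  -- source
  have sd0 := deriv_smooth (sδ i0)
  have sδ0 := sδ i0
  let κ : ℝ × ℝ → ℝ × ℝ := fun p => (δ i0 p.2 + p.1 * deriv (δ i0) p.2, δ i0 p.2)
  have sκ : ContDiff ℝ ∞ κ := by fun_prop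
  have κ0 : κ 0 = 0 := by simp [κ, h0]
  have κt : Tendsto κ (𝓝 0) (𝓝 0) := by have := sκ.continuous.tendsto 0; rwa [κ0] at this
  let Ψ : ℝ × ℝ → ℝ × ℝ := fun p => (-3/2 * (κ p).1, X (κ p))
  have sXκ : ContDiff ℝ ∞ (fun p => X (κ p)) := sX.comp sκ
  have sΨ : ContDiff ℝ ∞ Ψ := (contDiff_const.mul (contDiff_fst.comp sκ)).prodMk sXκ
  have Ψ0 : Ψ 0 = 0 := by simp [Ψ, κ0, X0]
  obtain ⟨Ψinv, sΨi, -, l1, l2⟩ := smooth_inv Ψ sΨ Ψ0 (by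
    intro w hw
    obtain ⟨r, sr, kr, Dr⟩ := div_id (δ i0) (sδ i0) (h0 i0)
    have r0 : r 0 = 1 := by have := Dr 0; rw [zero_add, iteratedDeriv_one, d0] at this; simpa using this.symm
    have dκ : fderiv ℝ κ 0 w = (w.2 + w.1, w.2) := by
      have crr := sr.continuous
      have cdd := sd0.continuous
      have cc : Continuous (fun x : ℝ => (w.2 * r (x * w.2) + w.1 * deriv (δ i0) (x * w.2), w.2 * r (x * w.2))) := by fun_prop
      rw [lin κ (sκ.differentiable (by simp) 0) w (fun x => (w.2 * r (x * w.2) + w.1 * deriv (δ i0) (x * w.2), w.2 * r (x * w.2)))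
        cc.continuousAt (Eventually.of_forall fun x => by
          simp only [κ, Prod.smul_fst, Prod.smul_snd, smul_eq_mul, Prod.smul_mk, kr (x * w.2)]
          refine Prod.ext ?_ ?_ <;> simp only <;> ring)]
      simp [r0, d0]
    have hκ := (sκ.differentiable (by simp) 0).hasFDerivAt
    have hXd : HasFDerivAt X (fderiv ℝ X 0) (κ 0) := by rw [κ0]; exact (sX.differentiable (by simp) 0).hasFDerivAt
    have c2 := hXd.comp 0 hκ
    have c1 := (hasFDerivAt_fst (𝕜 := ℝ) (p := κ 0)).comp 0 hκ |>.const_mul (-3/2 : ℝ)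
    have c3 : HasFDerivAt Ψ _ 0 := c1.prodMk c2
    rw [c3.fderiv] at hw
    simp only [ContinuousLinearMap.prod_apply, ContinuousLinearMap.smul_apply, ContinuousLinearMap.comp_apply, dκ, dX,
      ContinuousLinearMap.coe_fst', smul_eq_mul, Prod.mk_eq_zero] at hw
    obtain ⟨w1, w2⟩ := w
    simp only at hw
    refine Prod.ext ?_ ?_ <;> simp only [Prod.fst_zero, Prod.snd_zero] <;> linarith [hw.1, hw.2])
  refine ⟨T, Tinv, Ψ, Ψinv, sT, sTi, T0, Ti0, k1, k2, sΨ, sΨi, Ψ0, l1, l2, ?_⟩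
  have snd0 : Tendsto (fun p : ℝ × ℝ => p.2) (𝓝 0) (𝓝 0) := by
    have := (continuous_snd (X := ℝ) (Y := ℝ)).tendsto 0; simpa using this
  have key : ∀ᶠ p : ℝ × ℝ in 𝓝 0, ∀ i : Fin m, (i:ℕ) ≠ 0 → δ i p.2 + p.1 * deriv (δ i) p.2 = hh (e i) (κ p).1 (κ p).2 := by
    filter_upwards [snd0.eventually hφδ.eventually_nhds] with p hp i hi
    have g1 : (δ i) =ᶠ[𝓝 p.2] fun t => (δ i0 t)^3 * e i (δ i0 t) := by
      filter_upwards [hp] with t ht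
      rw [← (re i hi).1, ht]
    have g2 := g1.self_of_nhds
    have dd0 := ((sδ i0).differentiable (by simp) p.2).hasDerivAt
    have de := (((se i).differentiable (by simp) (δ i0 p.2)).hasDerivAt).comp p.2 dd0
    have dp := (dd0.pow 3).mul de
    have g3 : deriv (δ i) p.2 = _ := g1.deriv_eq.trans dp.deriv
    rw [g2, g3]
    simp only [hh, κ, Pi.pow_apply, Function.comp_apply]
    push_cast
    ring
  filter_upwards [key, κt.eventually hX1, κt.eventually (eventually_all.2 ha)] with p hk hx1 hx i
  rw [hT]
  have m0 : mond m (Ψ p) i0 = -3/2 * (κ p).1 := by simp [mond, hi0, Ψ]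
  have m1 : mond m (Ψ p) i1 = X (κ p) ^ 3 + -3/2 * (κ p).1 * X (κ p) ^ 2 := by simp [mond, hi1, Ψ]
  have m2 : mond m (Ψ p) i2 = (3/4) * X (κ p) ^ 4 + (2/3) * (-3/2 * (κ p).1) * X (κ p) ^ 3 := by simp [mond, hi2, Ψ]
  have m3 : mond m (Ψ p) i3 = (3/5) * X (κ p) ^ 5 + (1/2) * (-3/2 * (κ p).1) * X (κ p) ^ 4 := by simp [mond, hi3, Ψ]
  have u0 : -2/3 * (-3/2 * (κ p).1) = (κ p).1 := by ring
  split_ifs with c0 c1 c4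
  · have : i = i0 := Fin.ext c0
    rw [this, m0, u0]
  · have : i = i1 := Fin.ext c1
    rw [hk i c0, m0, m1, u0, this, hx1]
    ring
  · rw [hk i c0, m0, m1, m2, m3, alpha_mond, hx i, zero_add]
  · have mi : mond m (Ψ p) i = 0 := by
      unfold mond
      rw [if_neg (by omega), if_neg (by omega), if_neg (by omega), if_neg (by omega)]
    rw [hk i c0, m0, m1, m2, m3, alpha_mond, hx i, mi, zero_add]

end Mond

open Filter Topology
open scoped ContDiff
namespace Mond

theorem mond_continuous (m : ℕ) : Continuous (mond m) := by
  refine continuous_pi fun i => ?_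
  unfold mond
  split_ifs <;> fun_prop

theorem mond_zero (m : ℕ) : mond m 0 = 0 := by
  funext i
  simp [mond]

theorem final (m : ℕ) (hm : 4 ≤ m)
    (γ : ℝ → Fin m → ℝ) (hγ : ContDiff ℝ ∞ γ)
    (h2 : iteratedDeriv 2 γ 0 ∈ Submodule.span ℝ ({iteratedDeriv 1 γ 0} : Set (Fin m → ℝ)))
    (h5 : Module.finrank ℝ ↥(Submodule.span ℝ
      ({iteratedDeriv 1 γ 0, iteratedDeriv 2 γ 0, iteratedDeriv 3 γ 0,
        iteratedDeriv 4 γ 0, iteratedDeriv 5 γ 0} : Set (Fin m → ℝ))) = 4) :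
    ∃ σ σinv : ℝ × ℝ → ℝ × ℝ, ∃ τ τinv : (Fin m → ℝ) → (Fin m → ℝ),
    σ 0 = 0 ∧ τ (γ 0) = 0 ∧
    ContDiff ℝ ∞ σ ∧ ContDiff ℝ ∞ σinv ∧
    ContDiff ℝ ∞ τ ∧ ContDiff ℝ ∞ τinv ∧
    (∀ᶠ x in 𝓝 0, σinv (σ x) = x) ∧ (∀ᶠ y in 𝓝 0, σ (σinv y) = y) ∧
    (∀ᶠ z in 𝓝 (γ 0), τinv (τ z) = z) ∧ (∀ᶠ w in 𝓝 0, τ (τinv w) = w) ∧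
    (∀ᶠ p : ℝ × ℝ in 𝓝 0, mond m (σ p) = τ (γ p.2 + p.1 • deriv γ p.2)) := by
  have li := indep _ _ _ _ _ h2 h5
  let w : Fin 4 → Fin m → ℝ := fun j => Pi.single (Fin.castLE hm j) 1
  have lw : LinearIndependent ℝ w := by
    have := (Pi.basisFun ℝ (Fin m)).linearIndependent.comp (Fin.castLE hm) (Fin.castLE_injective hm)
    convert this using 1
    funext j
    simp [w]
  obtain ⟨L, hL⟩ := exists_equiv _ w li lw
  let ℓ : Fin m → (Fin m → ℝ) →L[ℝ] ℝ := fun i => (ContinuousLinearMap.proj i).comp (L : (Fin m → ℝ) →L[ℝ] (Fin m → ℝ))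
  let δ : Fin m → ℝ → ℝ := fun i t => ℓ i (γ t) - ℓ i (γ 0)
  have hd : ∀ i k t, iteratedDeriv (k+1) (δ i) t = L (iteratedDeriv (k+1) γ t) i := by
    intro i k t
    have := congrFun (iteratedDeriv_clm (ℓ i) γ hγ (ℓ i (γ 0)) k) t
    exact this
  have e1 := hL 0
  have e3 := hL 1
  have e4 := hL 2
  have e5 := hL 3
  simp only [Matrix.cons_val] at e1 e3 e4 e5
  have single : ∀ (j : Fin 4) (i : Fin m), w j i = if (i:ℕ) = (j:ℕ) then 1 else 0 := by
    intro j i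
    simp only [w, Pi.single_apply, Fin.ext_iff, Fin.val_castLE]
  obtain ⟨T, Tinv, Ψ, Ψinv, sT, sTinv, T0, Tinv0, k1, k2, sΨ, sΨinv, Ψ0, j1, j2, main⟩ := normal_form m hm δ
    (fun i => by
      have : ContDiff ℝ ∞ (fun t => ℓ i (γ t)) := (ℓ i).contDiff.comp hγ
      exact this.sub contDiff_const)
    (fun i => by simp [δ])
    (fun i => by rw [hd i 0, e1, single]; simp)
    (fun i hi => by
      obtain ⟨c, hc⟩ := Submodule.mem_span_singleton.1 h2
      rw [hd i 1, ← hc, map_smul, e1, Pi.smul_apply, single]; simp [hi])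
    (fun i => by rw [hd i 2, e3, single]; simp)
    (fun i => by rw [hd i 3, e4, single]; simp)
    (fun i => by rw [hd i 4, e5, single]; simp)
  have tau0 : Tendsto (fun z => L (z - γ 0)) (𝓝 (γ 0)) (𝓝 0) := by
    have : Continuous (fun z => L (z - γ 0)) := L.continuous.comp (continuous_id.sub continuous_const)
    have := this.tendsto (γ 0)
    simpa using this
  refine ⟨Ψ, Ψinv, fun z => Tinv (L (z - γ 0)), fun y => γ 0 + L.symm (T y), Ψ0, by simp [Tinv0], sΨ, sΨinv,
    sTinv.comp (L.contDiff.comp (contDiff_id.sub contDiff_const)),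
    contDiff_const.add (L.symm.contDiff.comp sT), j1, j2, ?_, ?_, ?_⟩
  · filter_upwards [tau0.eventually k2] with z hz
    rw [hz]; simp
  · filter_upwards [k1] with y hy
    simpa using hy
  · have c : Tendsto (fun p => mond m (Ψ p)) (𝓝 0) (𝓝 0) := by
      have := ((mond_continuous m).comp sΨ.continuous).tendsto 0
      simpa [Function.comp_def, Ψ0, mond_zero] using this
    filter_upwards [main, c.eventually k1] with p hp hk
    have : L (γ p.2 + p.1 • deriv γ p.2 - γ 0) = T (mond m (Ψ p)) := by
      funext i
      rw [← hp i]
      have := hd i 0 p.2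
      rw [zero_add, iteratedDeriv_one, iteratedDeriv_one] at this
      rw [this]
      simp only [δ, ℓ, map_sub, map_add, map_smul, Pi.sub_apply, Pi.add_apply, Pi.smul_apply, smul_eq_mul]
      simp
      ring
    rw [this, hk]

end Mond


/-- In `ℝ^m`, `m ≥ 4`, the tangent variety to a finite-type curve `γ` of type
`(1,3,4,5,a₅,…,a_m)` at `0` is locally diffeomorphic to the open Mond surface
`(u, x) ↦ (u, x³ + ux², (3/4)x⁴ + (2/3)ux³, (3/5)x⁵ + (1/2)ux⁴, 0, …, 0)`. -/
theorem tangent_variety_type_1345_open_Mond_surface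
    (m : ℕ) (hm : 4 ≤ m)
    (γ : ℝ → Fin m → ℝ) (hγ : ContDiff ℝ (⊤ : ℕ∞) γ)
    (hfin : Submodule.span ℝ
      (Set.range fun k : ℕ => iteratedDeriv (k + 1) γ 0) = (⊤ : Submodule ℝ (Fin m → ℝ)))
    (h1 : deriv γ 0 ≠ 0)
    (h2 : iteratedDeriv 2 γ 0 ∈ Submodule.span ℝ ({iteratedDeriv 1 γ 0} : Set (Fin m → ℝ)))
    (h3 : Module.finrank ℝ ↥(Submodule.span ℝ
      ({iteratedDeriv 1 γ 0, iteratedDeriv 2 γ 0, iteratedDeriv 3 γ 0} : Set (Fin m → ℝ))) = 2)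
    (h4 : Module.finrank ℝ ↥(Submodule.span ℝ
      ({iteratedDeriv 1 γ 0, iteratedDeriv 2 γ 0, iteratedDeriv 3 γ 0,
        iteratedDeriv 4 γ 0} : Set (Fin m → ℝ))) = 3)
    (h5 : Module.finrank ℝ ↥(Submodule.span ℝ
      ({iteratedDeriv 1 γ 0, iteratedDeriv 2 γ 0, iteratedDeriv 3 γ 0,
        iteratedDeriv 4 γ 0, iteratedDeriv 5 γ 0} : Set (Fin m → ℝ))) = 4) :
    GermEquiv (fun p : ℝ × ℝ => γ p.2 + p.1 • deriv γ p.2) (0 : ℝ × ℝ)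
      (fun p : ℝ × ℝ => fun i : Fin m =>
        if (i : ℕ) = 0 then p.1
        else if (i : ℕ) = 1 then p.2 ^ 3 + p.1 * p.2 ^ 2
        else if (i : ℕ) = 2 then (3/4) * p.2 ^ 4 + (2/3) * p.1 * p.2 ^ 3
        else if (i : ℕ) = 3 then (3/5) * p.2 ^ 5 + (1/2) * p.1 * p.2 ^ 4
        else 0) (0 : ℝ × ℝ) := by
  obtain ⟨σ, σinv, τ, τinv, a1, a2, a3, a4, a5, a6, a7, a8, a9, a10, a11⟩ := Mond.final m hm γ hγ h2 h5
  have f0 : (fun p : ℝ × ℝ => γ p.2 + p.1 • deriv γ p.2) 0 = γ 0 := by simp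
  have g0 := Mond.mond_zero m
  change GermEquiv _ _ (Mond.mond m) _
  refine ⟨σ, σinv, τ, τinv, a1, ?_, a3.contDiffAt, a4.contDiffAt, a5.contDiffAt, a6.contDiffAt, a7, a8, ?_, ?_, a11⟩
  · rw [f0, g0]; exact a2
  · rw [f0]; exact a9
  · rw [g0]; exact a10
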